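/- With the microlocal decomposition and the collection of bad functions as in the context, there is a constant C depending only on d and γ such that ‖ Σ_{j∈ℤ} Σ_v G_v^s T_j^v 𝔅_{j−s} ‖²_{L²(ℝ^d)} ≤ C ‖Ω₂‖_∞² 2^{−sγ} α Σ_{Q∈𝔔} ‖b_Q‖_{L¹(ℝ^d)}. -/

import Mathlib

open MeasureTheory Metric Set FourierTransform
open scoped ENNReal RealInnerProductSpace

noncomputable section

abbrev Rd (d : ℕ) : Type := EuclideanSpace ℝ (Fin d)

/-- Surface measure on the unit sphere `S^{d-1}`. -/
def sphereMeasure (d : ℕ) : Measure (sphere (0 : Rd d) 1) :=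
  (volume : Measure (Rd d)).toSphere

/-- Integral over the sphere of a function defined on `ℝ^d`. -/
def sphInt (d : ℕ) (g : Rd d → ℝ) : ℝ :=
  ∫ θ : sphere (0 : Rd d) 1, g (θ : Rd d) ∂(sphereMeasure d)

/-- `‖Ω‖₁`, the `L¹(S^{d-1})` norm of `Ω`. -/
def omegaL1 (d : ℕ) (Ω : Rd d → ℝ) : ℝ := sphInt d (fun x => |Ω x|)

/-- `‖Ω‖_{LlogL(S^{d-1})}`. -/
def omegaLlogL (d : ℕ) (Ω : Rd d → ℝ) : ℝ :=
  sphInt d (fun x => |Ω x| * Real.log (2 + |Ω x|))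

/-- The constant `C_Ω`. -/
def constCOmega (d : ℕ) (Ω : Rd d → ℝ) : ℝ :=
  omegaLlogL d Ω +
    sphInt d (fun x => |Ω x| * (1 + max (Real.log (|Ω x| / omegaL1 d Ω)) 0))

/-- `Ω` is homogeneous of degree zero on `ℝ^d ∖ {0}`. -/
def Homogeneous0 (d : ℕ) (Ω : Rd d → ℝ) : Prop :=
  ∀ x : Rd d, x ≠ 0 → ∀ r : ℝ, 0 < r → Ω (r • x) = Ω x

/-- The hypotheses on `Ω`: homogeneity of degree `0`, integrability on the sphere,
the cancellation condition, and `Ω ∈ L log L(S^{d-1})`. -/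
def OmegaHyp (d : ℕ) (Ω : Rd d → ℝ) : Prop :=
  Homogeneous0 d Ω ∧
  Integrable (fun θ : sphere (0 : Rd d) 1 => Ω (θ : Rd d)) (sphereMeasure d) ∧
  (∫ θ : sphere (0 : Rd d) 1, Ω (θ : Rd d) ∂(sphereMeasure d)) = 0 ∧
  Integrable (fun θ : sphere (0 : Rd d) 1 => |Ω (θ : Rd d)| * Real.log (2 + |Ω (θ : Rd d)|))
    (sphereMeasure d)

/-- `φ` is smooth, supported in the annulus `{2^{-4} < |x| < 2^{-2}}` and
satisfies the partition of unity condition `Σ_j φ(2^{-j} x) = 1` for `x ≠ 0`. -/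
def AdmissiblePhi (d : ℕ) (φ : Rd d → ℝ) : Prop :=
  ContDiff ℝ (⊤ : ℕ∞) φ ∧
  tsupport φ ⊆ {x : Rd d | (2:ℝ) ^ (-4 : ℤ) < ‖x‖ ∧ ‖x‖ < (2:ℝ) ^ (-2 : ℤ)} ∧
  ∀ x : Rd d, x ≠ 0 → HasSum (fun j : ℤ => φ ((2:ℝ) ^ (-j) • x)) 1

/-- The kernel `𝒦_j(x) = φ(2^{-j}x) Ω(x) |x|^{-d}`. -/
def Kker (d : ℕ) (φ Om : Rd d → ℝ) (j : ℤ) (x : Rd d) : ℝ :=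
  φ ((2:ℝ) ^ (-j) • x) * Om x * ‖x‖ ^ (-(d : ℤ))

/-- The dyadic operator `T_j f = 𝒦_j * f`. -/
def Tj (d : ℕ) (φ Om : Rd d → ℝ) (j : ℤ) (f : Rd d → ℝ) (x : Rd d) : ℝ :=
  ∫ y, Kker d φ Om j (x - y) * f y

/-- The maximal dyadic truncated operator `T_* f(x) = sup_l |Σ_{j ≥ l} T_j f(x)|`. -/
def TStar (d : ℕ) (φ Om f : Rd d → ℝ) (x : Rd d) : ℝ≥0∞ :=
  ⨆ l : ℤ, ENNReal.ofReal |∑' j : {j : ℤ // l ≤ j}, Tj d φ Om (j : ℤ) f x|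

/-- The dyadic cube `2^k w + ∏_i [m_i 2^k, (m_i+1) 2^k)` in the shifted grid `𝔇^w`. -/
def dcube (d : ℕ) (w : Fin d → ℝ) (k : ℤ) (m : Fin d → ℤ) : Set (Rd d) :=
  {x | ∀ i : Fin d, (2:ℝ) ^ k * (w i + m i) ≤ x i ∧ x i < (2:ℝ) ^ k * (w i + m i + 1)}

/-- The concentric cube `½K` of half the sidelength. -/
def dhalf (d : ℕ) (w : Fin d → ℝ) (k : ℤ) (m : Fin d → ℤ) : Set (Rd d) :=
  {x | ∀ i : Fin d,
    (2:ℝ) ^ k * (w i + m i + 1/4) ≤ x i ∧ x i < (2:ℝ) ^ k * (w i + m i + 3/4)}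

/-- `w ∈ {0, 1/2}^d`. -/
def GridShift (d : ℕ) (w : Fin d → ℝ) : Prop := ∀ i, w i = 0 ∨ w i = 1/2

/-- The Calderón–Zygmund decomposition data at level `λ/C_Ω`: a countable collection
`Qset` of pairwise disjoint standard dyadic cubes and bad functions `b_Q` with
`supp b_Q ⊆ Q`, `∫ b_Q = 0`, `‖b_Q‖₁ ≤ C⟨f⟩_Q |Q|` and `⟨f⟩_Q ≈ λ/C_Ω`. -/
structure CZData (d : ℕ) (COm Cc c₁ c₂ : ℝ) (f : Rd d → ℝ) (lam : ℝ)
    (Qset : Set (ℤ × (Fin d → ℤ))) (b : ℤ × (Fin d → ℤ) → Rd d → ℝ) : Prop where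
  pairwise_disjoint : Qset.Pairwise fun q q' =>
    Disjoint (dcube d 0 q.1 q.2) (dcube d 0 q'.1 q'.2)
  support_subset : ∀ q ∈ Qset, Function.support (b q) ⊆ dcube d 0 q.1 q.2
  integrable : ∀ q ∈ Qset, Integrable (b q)
  integral_zero : ∀ q ∈ Qset, (∫ x, b q x) = 0
  l1_bound : ∀ q ∈ Qset, (∫ x, |b q x|) ≤ Cc * ∫ x in dcube d 0 q.1 q.2, |f x|
  avg_lower : ∀ q ∈ Qset, c₁ * lam / COm ≤
    (∫ x in dcube d 0 q.1 q.2, |f x|) / (volume (dcube d 0 q.1 q.2)).toReal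
  avg_upper : ∀ q ∈ Qset,
    (∫ x in dcube d 0 q.1 q.2, |f x|) / (volume (dcube d 0 q.1 q.2)).toReal ≤ c₂ * lam / COm

/-- `b_m = Σ_{Q ∈ 𝒬, l(Q) = 2^m} b_Q`. -/
def bsum (d : ℕ) (Qset : Set (ℤ × (Fin d → ℤ))) (b : ℤ × (Fin d → ℤ) → Rd d → ℝ)
    (m : ℤ) (x : Rd d) : ℝ :=
  ∑' mv : Fin d → ℤ, Set.indicator Qset (fun q => b q x) (m, mv)

/-- `φ` is smooth and supported in the annulus `{2^{-4} < |x| < 2^{-2}}`. -/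
def PhiSupp (d : ℕ) (φ : Rd d → ℝ) : Prop :=
  ContDiff ℝ (⊤ : ℕ∞) φ ∧
  tsupport φ ⊆ {x : Rd d | (2:ℝ) ^ (-4 : ℤ) < ‖x‖ ∧ ‖x‖ < (2:ℝ) ^ (-2 : ℤ)}

/-- The cutoff `Φ`: smooth, `0 ≤ Φ ≤ 1`, `Φ = 1` on `|t| ≤ 2` and `Φ = 0` on `|t| > 4`. -/
def CutoffHyp (Φ : ℝ → ℝ) : Prop :=
  ContDiff ℝ (⊤ : ℕ∞) Φ ∧ (∀ t, 0 ≤ Φ t ∧ Φ t ≤ 1) ∧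
  (∀ t : ℝ, |t| ≤ 2 → Φ t = 1) ∧ (∀ t : ℝ, 4 < |t| → Φ t = 0)

/-- The microlocal kernel `𝒦_j^v(x) = 𝒦_j(x) χ_{E}(x/|x|)`. -/
def Kv (d : ℕ) (φ Om : Rd d → ℝ) (E : Set (Rd d)) (j : ℤ) (x : Rd d) : ℝ :=
  Kker d φ Om j x * Set.indicator E (fun _ => (1:ℝ)) (‖x‖⁻¹ • x)

/-- The microlocal piece `T_j^v g = 𝒦_j^v * g`. -/
def Tjv (d : ℕ) (φ Om : Rd d → ℝ) (E : Set (Rd d)) (j : ℤ) (g : Rd d → ℝ) (x : Rd d) : ℝ :=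
  ∫ y, Kv d φ Om E j (x - y) * g y

/-- The Fourier multiplier operator `G_v^s` with symbol `Φ(2^{sγ}⟨e_v, ξ/|ξ|⟩)`. -/
def Gop (d : ℕ) (Φ : ℝ → ℝ) (γ : ℝ) (s : ℕ) (e : Rd d) (g : Rd d → ℂ) (x : Rd d) : ℂ :=
  𝓕⁻ (fun ξ : Rd d => (Φ ((2:ℝ) ^ (γ * s) * ⟪e, ‖ξ‖⁻¹ • ξ⟫) : ℂ) * 𝓕 g ξ) x

/-- The microlocal decomposition: a `2^{-sγ-4}`-separated family of unit vectors `e_v`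
and disjoint measurable sets `E_v ⊆ S^{d-1}` of diameter at most `2^{-sγ-2}` with
`e_v ∈ E_v` covering the sphere. -/
def MicroFamily (d : ℕ) (γ : ℝ) (s : ℕ) {V : Type} (e : V → Rd d)
    (E : V → Set (Rd d)) : Prop :=
  (∀ v, ‖e v‖ = 1) ∧
  (∀ v v', v ≠ v' → (2:ℝ) ^ (-(s:ℝ) * γ - 4) ≤ ‖e v - e v'‖) ∧
  (∀ v, MeasurableSet (E v)) ∧
  (∀ v, E v ⊆ Metric.sphere (0 : Rd d) 1) ∧
  (Pairwise fun v v' => Disjoint (E v) (E v')) ∧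
  (∀ v, e v ∈ E v) ∧
  (∀ v, Metric.diam (E v) ≤ (2:ℝ) ^ (-(s:ℝ) * γ - 2)) ∧
  (⋃ v, E v) = Metric.sphere (0 : Rd d) 1

/-- A collection of dyadic cubes with pairwise disjoint interiors carrying bad functions
`b_Q` with `supp b_Q ⊆ Q` and `‖b_Q‖_{L¹} ≤ α|Q|`. -/
def BadFam (d : ℕ) (Qset : Set (ℤ × (Fin d → ℤ)))
    (b : ℤ × (Fin d → ℤ) → Rd d → ℝ) (α : ℝ) : Prop :=
  (Qset.Pairwise fun q q' =>
    Disjoint (interior (dcube d 0 q.1 q.2)) (interior (dcube d 0 q'.1 q'.2))) ∧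
  (∀ q ∈ Qset, Function.support (b q) ⊆ dcube d 0 q.1 q.2) ∧
  (∀ q ∈ Qset, Integrable (b q)) ∧
  (∀ q ∈ Qset, (∫ x, |b q x|) ≤ α * (volume (dcube d 0 q.1 q.2)).toReal)

section

open SchwartzMap

theorem continuous_fourier_of_integrable {d : ℕ} {f : Rd d → ℂ} (hf : Integrable f) :
    Continuous (𝓕 f) :=
  VectorFourier.fourierIntegral_continuous Real.continuous_fourierChar
    (L := innerₗ (Rd d)) continuous_inner hf

theorem integral_fourier_smul_eq {d : ℕ} {f g : Rd d → ℂ} (hf : Integrable f)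
    (hg : Integrable g) : ∫ ξ, 𝓕 f ξ • g ξ = ∫ x, f x • 𝓕 g x := by
  have h := VectorFourier.integral_fourierIntegral_smul_eq_flip (μ := volume) (ν := volume)
    Real.continuous_fourierChar
    (L := innerₗ (Rd d)) continuous_inner hf hg
  rw [flip_innerₗ] at h
  exact h

theorem fourier_toLp_ae_eq {d : ℕ} {f : Rd d → ℂ} (hf : Integrable f)
    (hf2 : MemLp f 2) : (𝓕 (hf2.toLp f) : Lp ℂ 2 volume) =ᵐ[volume] 𝓕 f := by
  apply ae_eq_of_integral_contDiff_smul_eq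
  · exact (Lp.memLp _).locallyIntegrable (by norm_num)
  · exact (continuous_fourier_of_integrable hf).locallyIntegrable
  intro g hg hgc
  have hgc' : HasCompactSupport (fun x => (g x : ℂ)) := hgc.comp_left (g := Complex.ofReal) rfl
  have hg' : ContDiff ℝ (↑(⊤ : ℕ∞)) (fun x => (g x : ℂ)) := Complex.ofRealCLM.contDiff.comp hg
  set ψ : 𝓢(Rd d, ℂ) := hgc'.toSchwartzMap hg' with hψ
  have hψx : ∀ x, ψ x = (g x : ℂ) := fun x => rfl
  have h1 := congrArg (fun D => D ψ) (Lp.fourier_toTemperedDistribution_eq (hf2.toLp f))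
  simp only [Lp.toTemperedDistribution_apply, TemperedDistribution.fourier_apply] at h1
  have h2 : ∫ x, g x • (𝓕 (hf2.toLp f) : Lp ℂ 2 volume) x
      = ∫ x, ψ x • (𝓕 (hf2.toLp f) : Lp ℂ 2 volume) x := by
    simp [hψx]
  rw [h2, ← h1]
  have h3 := integral_fourier_smul_eq hf ψ.integrable
  have h4 : ∫ x, (𝓕 ψ) x • (hf2.toLp f) x = ∫ x, f x • 𝓕 (ψ : Rd d → ℂ) x := by
    apply integral_congr_ae
    filter_upwards [hf2.coeFn_toLp] with x hx
    rw [hx, SchwartzMap.fourier_coe, smul_eq_mul, smul_eq_mul, mul_comm]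
  rw [h4, ← h3]
  congr 1
  ext x
  simp [hψx, mul_comm]

theorem eLpNorm_fourier_eq {d : ℕ} {f : Rd d → ℂ} (hf : Integrable f)
    (hf2 : MemLp f 2) : eLpNorm (𝓕 f) 2 volume = eLpNorm f 2 volume := by
  rw [← eLpNorm_congr_ae (fourier_toLp_ae_eq hf hf2), ← eLpNorm_congr_ae hf2.coeFn_toLp,
    ← Lp.enorm_def, ← Lp.enorm_def, enorm_eq_iff_norm_eq, Lp.norm_fourier_eq]

theorem eLpNorm_fourierInv_eq {d : ℕ} {f : Rd d → ℂ} (hf : Integrable f)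
    (hf2 : MemLp f 2) : eLpNorm (𝓕⁻ f) 2 volume = eLpNorm f 2 volume := by
  rw [← eLpNorm_fourier_eq hf hf2]
  have : 𝓕⁻ f = 𝓕 f ∘ (fun x => -x) := by
    ext x; exact Real.fourierInv_eq_fourier_neg f x
  rw [this, eLpNorm_comp_measurePreserving
    (continuous_fourier_of_integrable hf).aestronglyMeasurable (Measure.measurePreserving_neg _)]

theorem sq_eLpNorm_two {α : Type*} [MeasurableSpace α] {μ : Measure α} (f : α → ℂ) :
    eLpNorm f 2 μ ^ 2 = ∫⁻ x, ‖f x‖ₑ ^ 2 ∂μ := by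
  have := eLpNorm_nnreal_pow_eq_lintegral (μ := μ) (f := f) (p := 2) (by norm_num)
  simpa using this

theorem fourier_finset_sum {d : ℕ} {ι : Type*} (s : Finset ι) {f : ι → Rd d → ℂ}
    (hf : ∀ i ∈ s, Integrable (f i)) (ξ : Rd d) :
    𝓕 (fun x => ∑ i ∈ s, f i x) ξ = ∑ i ∈ s, 𝓕 (f i) ξ := by
  simp only [Real.fourier_eq, Finset.smul_sum]
  exact integral_finsetSum s fun i hi => (Real.fourierIntegral_convergent_iff ξ).2 (hf i hi)

theorem fourierInv_finset_sum {d : ℕ} {ι : Type*} (s : Finset ι)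
    {f : ι → Rd d → ℂ}
    (hf : ∀ i ∈ s, Integrable (f i)) (x : Rd d) :
    𝓕⁻ (fun x => ∑ i ∈ s, f i x) x = ∑ i ∈ s, 𝓕⁻ (f i) x := by
  simp only [Real.fourierInv_eq_fourier_neg]
  exact fourier_finset_sum s hf _

theorem fourier_eq_zero_of_not_integrable {d : ℕ} {f : Rd d → ℂ}
    (hf : ¬ Integrable f) (ξ : Rd d) : 𝓕 f ξ = 0 := by
  rw [Real.fourier_eq]
  exact integral_undef (mt (Real.fourierIntegral_convergent_iff ξ).1 hf)

theorem fourier_zero_fun {d : ℕ} (ξ : Rd d) :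
    𝓕 (fun _ : Rd d => (0 : ℂ)) ξ = 0 := by
  simp [Real.fourier_eq]

theorem enorm_sum_mul_sq_le {ι : Type*} (s : Finset ι) (f : ι → ℝ) (z : ι → ℂ) {N : ℝ}
    (hN : ∑ i ∈ s, f i ^ 2 ≤ N) :
    ‖∑ i ∈ s, (f i : ℂ) * z i‖ₑ ^ 2 ≤ ENNReal.ofReal N * ∑ i ∈ s, ‖z i‖ₑ ^ 2 := by
  have h0 : 0 ≤ N := (Finset.sum_nonneg fun i _ => sq_nonneg _).trans hN
  have h1 : ‖∑ i ∈ s, (f i : ℂ) * z i‖ ^ 2 ≤ N * ∑ i ∈ s, ‖z i‖ ^ 2 := by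
    calc ‖∑ i ∈ s, (f i : ℂ) * z i‖ ^ 2 ≤ (∑ i ∈ s, |f i| * ‖z i‖) ^ 2 := by
          gcongr
          refine (norm_sum_le _ _).trans (le_of_eq ?_)
          simp
      _ ≤ (∑ i ∈ s, |f i| ^ 2) * ∑ i ∈ s, ‖z i‖ ^ 2 := Finset.sum_mul_sq_le_sq_mul_sq _ _ _
      _ ≤ _ := by
          simp only [sq_abs]
          gcongr
  have h2 := ENNReal.ofReal_le_ofReal h1
  rw [ENNReal.ofReal_mul h0, ENNReal.ofReal_sum_of_nonneg (fun i _ => by positivity),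
    ENNReal.ofReal_pow (norm_nonneg _), ofReal_norm] at h2
  simpa only [ENNReal.ofReal_pow (norm_nonneg _), ofReal_norm] using h2

/-- An `L²` bound for sums of Fourier multipliers with bounded overlap. No integrability of the
pieces is needed, as the Fourier integrals of non-integrable functions vanish. -/
theorem lintegral_sum_multiplier_le {d : ℕ} {ι V : Type*} [Fintype V] (S : Finset ι)
    (m : V → Rd d → ℝ)
    (hm1 : ∀ v ξ, |m v ξ| ≤ 1) {N : ℝ} (hN : ∀ᵐ ξ, ∑ v, m v ξ ^ 2 ≤ N)
    (g : ι → V → Rd d → ℂ) (D : V → Rd d → ℝ≥0∞)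
    (hD : ∀ v x, ∑ j ∈ S, ‖g j v x‖ₑ ≤ D v x) (hfin : ∀ v, ∫⁻ x, D v x ^ 2 ≠ ∞) :
    Continuous (fun x => ∑ j ∈ S, ∑ v, 𝓕⁻ (fun ξ => (m v ξ : ℂ) * 𝓕 (g j v) ξ) x) ∧
    ∫⁻ x, ‖∑ j ∈ S, ∑ v, 𝓕⁻ (fun ξ => (m v ξ : ℂ) * 𝓕 (g j v) ξ) x‖ₑ ^ 2 ≤
      ENNReal.ofReal N * ∑ v, ∫⁻ x, D v x ^ 2 := by
  classical
  set good : ι → V → Prop := fun j v =>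
    Integrable (g j v) ∧ Integrable (fun ξ => (m v ξ : ℂ) * 𝓕 (g j v) ξ) with hgood
  set g' : ι → V → Rd d → ℂ :=
    fun j v => if good j v then g j v else fun _ => 0 with hg'
  have hg'int : ∀ j v, Integrable (g' j v) := by
    intro j v
    simp only [hg']
    split_ifs with h
    · exact h.1
    · exact integrable_zero _ _ _
  have hmint : ∀ j v, Integrable (fun ξ => (m v ξ : ℂ) * 𝓕 (g' j v) ξ) := by
    intro j v
    simp only [hg']
    split_ifs with h
    · exact h.2
    · simp only [fourier_zero_fun, mul_zero]
      exact integrable_zero _ _ _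
  have hrepl : ∀ j v x, 𝓕⁻ (fun ξ => (m v ξ : ℂ) * 𝓕 (g j v) ξ) x
      = 𝓕⁻ (fun ξ => (m v ξ : ℂ) * 𝓕 (g' j v) ξ) x := by
    intro j v x
    by_cases h : good j v
    · simp only [hg', if_pos h]
    · simp only [hg', if_neg h, fourier_zero_fun, mul_zero]
      by_cases h1 : Integrable (g j v)
      · have h2 : ¬ Integrable (fun ξ => (m v ξ : ℂ) * 𝓕 (g j v) ξ) := fun h2 => h ⟨h1, h2⟩
        rw [Real.fourierInv_eq_fourier_neg, Real.fourierInv_eq_fourier_neg,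
          fourier_eq_zero_of_not_integrable h2, fourier_zero_fun]
      · simp only [fourier_eq_zero_of_not_integrable h1, mul_zero]
  have hg'le : ∀ j v x, ‖g' j v x‖ₑ ≤ ‖g j v x‖ₑ := by
    intro j v x
    simp only [hg']
    split_ifs <;> simp
  set G : V → Rd d → ℂ := fun v x => ∑ j ∈ S, g' j v x with hG
  have hGint : ∀ v, Integrable (G v) := fun v => integrable_finsetSum _ fun j _ => hg'int j v
  have hGle : ∀ v x, ‖G v x‖ₑ ≤ D v x := fun v x =>
    (enorm_sum_le _ _).trans ((Finset.sum_le_sum fun j _ => hg'le j v x).trans (hD v x))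
  have hGsq : ∀ v, ∫⁻ x, ‖G v x‖ₑ ^ 2 ≤ ∫⁻ x, D v x ^ 2 := fun v =>
    lintegral_mono fun x => by gcongr; exact hGle v x
  have hG2 : ∀ v, MemLp (G v) 2 := by
    intro v
    refine ⟨(hGint v).1, ?_⟩
    have h : eLpNorm (G v) 2 volume ^ 2 < ∞ := by
      rw [sq_eLpNorm_two]
      exact (hGsq v).trans_lt (lt_top_iff_ne_top.2 (hfin v))
    exact lt_top_iff_ne_top.2 fun h' => by simp [h'] at h
  have hFG : ∀ v ξ, 𝓕 (G v) ξ = ∑ j ∈ S, 𝓕 (g' j v) ξ := fun v ξ =>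
    fourier_finset_sum S (fun j _ => hg'int j v) ξ
  set h : Rd d → ℂ := fun ξ => ∑ v, (m v ξ : ℂ) * 𝓕 (G v) ξ with hh
  have hmG : ∀ v, Integrable (fun ξ => (m v ξ : ℂ) * 𝓕 (G v) ξ) := by
    intro v
    simp only [hFG, Finset.mul_sum]
    exact integrable_finsetSum _ fun j _ => hmint j v
  have hhint : Integrable h := integrable_finsetSum _ fun v _ => hmG v
  have heq : ∀ x, ∑ j ∈ S, ∑ v, 𝓕⁻ (fun ξ => (m v ξ : ℂ) * 𝓕 (g j v) ξ) x = 𝓕⁻ h x := by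
    intro x
    rw [Finset.sum_comm, hh, fourierInv_finset_sum _ (fun v _ => hmG v)]
    refine Finset.sum_congr rfl fun v _ => ?_
    simp only [hFG, Finset.mul_sum]
    rw [fourierInv_finset_sum _ (fun j _ => hmint j v)]
    exact Finset.sum_congr rfl fun j _ => hrepl j v x
  have hFG2 : ∀ v, MemLp (𝓕 (G v)) 2 volume := fun v =>
    ⟨(continuous_fourier_of_integrable (hGint v)).aestronglyMeasurable, by
      rw [eLpNorm_fourier_eq (hGint v) (hG2 v)]; exact (hG2 v).2⟩
  have hh2 : MemLp h 2 := by
    refine memLp_finsetSum _ fun v _ => (hFG2 v).of_le (hmG v).1 (ae_of_all _ fun ξ => ?_)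
    rw [norm_mul, Complex.norm_real, Real.norm_eq_abs]
    exact mul_le_of_le_one_left (norm_nonneg _) (hm1 v ξ)
  simp only [heq]
  refine ⟨?_, ?_⟩
  · have : (fun x => 𝓕⁻ h x) = fun x => 𝓕 h (-x) := by
      ext x; exact Real.fourierInv_eq_fourier_neg h x
    rw [this]
    exact (continuous_fourier_of_integrable hhint).comp continuous_neg
  · rw [← sq_eLpNorm_two, eLpNorm_fourierInv_eq hhint hh2, sq_eLpNorm_two]
    calc ∫⁻ ξ, ‖h ξ‖ₑ ^ 2 ≤ ∫⁻ ξ, ENNReal.ofReal N * ∑ v, ‖𝓕 (G v) ξ‖ₑ ^ 2 := by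
          refine lintegral_mono_ae ?_
          filter_upwards [hN] with ξ hξ
          exact enorm_sum_mul_sq_le _ _ _ hξ
      _ = ENNReal.ofReal N * ∑ v, ∫⁻ ξ, ‖𝓕 (G v) ξ‖ₑ ^ 2 := by
          have hmeas : ∀ v, Measurable fun ξ => ‖𝓕 (G v) ξ‖ₑ ^ 2 := fun v =>
            (continuous_fourier_of_integrable (hGint v)).enorm.measurable.pow_const 2
          rw [lintegral_const_mul _ (Finset.measurable_sum _ fun v _ => hmeas v),
            lintegral_finsetSum _ (fun v _ => hmeas v)]
      _ ≤ _ := by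
          refine mul_le_mul_right (Finset.sum_le_sum fun v _ => ?_) _
          rw [← sq_eLpNorm_two, eLpNorm_fourier_eq (hGint v) (hG2 v), sq_eLpNorm_two]
          exact hGsq v

end

theorem lintegral_indicator_sub_mul {d : ℕ} {A : Set (Rd d)}
    (hA : MeasurableSet A) (f : Rd d → ℝ≥0∞) (x : Rd d) :
    ∫⁻ y in {y | x - y ∈ A}, f y = ∫⁻ y, A.indicator 1 (x - y) * f y := by
  have hset : MeasurableSet {y | x - y ∈ A} := (measurable_id.const_sub x) hA
  rw [← lintegral_indicator hset]
  refine lintegral_congr fun y => ?_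
  by_cases h : x - y ∈ A
  · rw [Set.indicator_of_mem (show y ∈ {y | x - y ∈ A} from h), Set.indicator_of_mem h]; simp
  · rw [Set.indicator_of_notMem (show y ∉ {y | x - y ∈ A} from h), Set.indicator_of_notMem h]; simp

section

variable {d : ℕ}

theorem measurable_lintegral_sub_mem {A : Set (Rd d)} (hA : MeasurableSet A)
    {f : Rd d → ℝ≥0∞} (hf : Measurable f) :
    Measurable fun x => ∫⁻ y in {y | x - y ∈ A}, f y := by
  simp only [lintegral_indicator_sub_mul hA]
  exact Measurable.lintegral_prod_right' (f := fun p : _ × Rd d =>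
    A.indicator 1 (p.1 - p.2) * f p.2)
    (((measurable_one.indicator hA).comp (measurable_fst.sub measurable_snd)).mul
      (hf.comp measurable_snd))

theorem measurable_lintegral_sub_mem' {A : Set (Rd d)} (hA : MeasurableSet A)
    {f : Rd d → ℝ≥0∞} (hf : Measurable f) :
    Measurable fun x => ∫⁻ y in {y | y - x ∈ A}, f y := by
  simpa using measurable_lintegral_sub_mem hA.neg hf

theorem lintegral_conv_mul_conv_le {A A' A₂ : Set (Rd d)}
    (hA : MeasurableSet A) (hA' : MeasurableSet A') (hA₂ : MeasurableSet A₂)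
    (hsub : ∀ u ∈ A, ∀ w ∈ A', u - w ∈ A₂)
    {f g : Rd d → ℝ≥0∞} (hf : Measurable f) (hg : Measurable g) :
    ∫⁻ x, (∫⁻ y in {y | x - y ∈ A}, f y) * (∫⁻ z in {z | x - z ∈ A'}, g z) ≤
      volume A' * ∫⁻ y, f y * ∫⁻ z in {z | z - y ∈ A₂}, g z := by
  simp only [lintegral_indicator_sub_mul hA, lintegral_indicator_sub_mul hA']
  have m1 : Measurable (A.indicator (1 : Rd d → ℝ≥0∞)) :=
    measurable_one.indicator hA
  have m2 : Measurable (A'.indicator (1 : Rd d → ℝ≥0∞)) :=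
    measurable_one.indicator hA'
  set F : Rd d → ℝ≥0∞ := fun x => ∫⁻ z, A'.indicator 1 (x - z) * g z with hF
  have hFm : Measurable F := by
    simpa only [lintegral_indicator_sub_mul hA'] using measurable_lintegral_sub_mem hA' hg
  calc ∫⁻ x, (∫⁻ y, A.indicator 1 (x - y) * f y) * F x
      = ∫⁻ x, ∫⁻ y, A.indicator 1 (x - y) * f y * F x := by
        refine lintegral_congr fun x => ?_
        rw [lintegral_mul_const]
        exact (m1.comp (measurable_const.sub measurable_id)).mul hf
    _ = ∫⁻ y, ∫⁻ x, A.indicator 1 (x - y) * f y * F x := by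
        refine lintegral_lintegral_swap (Measurable.aemeasurable ?_)
        exact ((m1.comp (measurable_fst.sub measurable_snd)).mul (hf.comp measurable_snd)).mul
          (hFm.comp measurable_fst)
    _ = ∫⁻ y, f y * ∫⁻ x, A.indicator 1 (x - y) * F x := by
        refine lintegral_congr fun y => ?_
        rw [← lintegral_const_mul]
        · exact lintegral_congr fun x => by ring
        · exact (m1.comp (measurable_id.sub measurable_const)).mul hFm
    _ ≤ ∫⁻ y, f y * (volume A' * ∫⁻ z in {z | z - y ∈ A₂}, g z) := by
        refine lintegral_mono fun y => mul_le_mul_right ?_ _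
        calc ∫⁻ x, A.indicator 1 (x - y) * F x
            = ∫⁻ x, ∫⁻ z, A.indicator 1 (x - y) * (A'.indicator 1 (x - z) * g z) := by
              refine lintegral_congr fun x => ?_
              rw [lintegral_const_mul]
              exact (m2.comp (measurable_const.sub measurable_id)).mul hg
          _ = ∫⁻ z, ∫⁻ x, A.indicator 1 (x - y) * (A'.indicator 1 (x - z) * g z) := by
              refine lintegral_lintegral_swap (Measurable.aemeasurable ?_)
              exact (m1.comp (measurable_fst.sub measurable_const)).mul
                ((m2.comp (measurable_fst.sub measurable_snd)).mul (hg.comp measurable_snd))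
          _ ≤ ∫⁻ z, volume A' * ({z | z - y ∈ A₂}.indicator g z) := by
              refine lintegral_mono fun z => ?_
              calc ∫⁻ x, A.indicator 1 (x - y) * (A'.indicator 1 (x - z) * g z)
                  ≤ ∫⁻ x, A'.indicator 1 (x - z) * ({z | z - y ∈ A₂}.indicator g z) := by
                    refine lintegral_mono fun x => ?_
                    by_cases h1 : x - y ∈ A
                    · by_cases h2 : x - z ∈ A'
                      · have h3 : z ∈ {z | z - y ∈ A₂} := by
                          have := hsub _ h1 _ h2
                          rwa [sub_sub_sub_cancel_left] at this
                        rw [Set.indicator_of_mem h3]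
                        simp [h1]
                      · simp [h2]
                    · simp [h1]
                _ = _ := by
                    rw [lintegral_mul_const _ (show Measurable fun x => A'.indicator 1 (x - z) from
                        m2.comp (measurable_id.sub_const z)),
                      lintegral_sub_right_eq_self (fun x => A'.indicator 1 x) z,
                      lintegral_indicator_one hA']
          _ = _ := by
              have hset : MeasurableSet {z | z - y ∈ A₂} := (measurable_id.sub_const y) hA₂
              rw [lintegral_const_mul _ (hg.indicator hset), lintegral_indicator hset]
    _ = volume A' * ∫⁻ y, f y * ∫⁻ z in {z | z - y ∈ A₂}, g z := by
        rw [← lintegral_const_mul]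
        · exact lintegral_congr fun y => by ring
        · exact hf.mul (measurable_lintegral_sub_mem' hA₂ hg)

theorem sq_sum_le_two_mul_sum_filter_le (S : Finset ℤ) (a : ℤ → ℝ≥0∞) :
    (∑ j ∈ S, a j) ^ 2 ≤ 2 * ∑ j ∈ S, ∑ i ∈ S with i ≤ j, a j * a i := by
  have h1 : ∑ j ∈ S, ∑ i ∈ S, a j * a i ≤
      ∑ j ∈ S, ∑ i ∈ S, ((if i ≤ j then a j * a i else 0) + (if j ≤ i then a j * a i else 0)) := by
    refine Finset.sum_le_sum fun j _ => Finset.sum_le_sum fun i _ => ?_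
    rcases le_total i j with h | h <;> simp [h]
  have h2 : ∑ j ∈ S, ∑ i ∈ S, (if j ≤ i then a j * a i else 0) =
      ∑ j ∈ S, ∑ i ∈ S, (if i ≤ j then a j * a i else 0) := by
    rw [Finset.sum_comm]
    simp only [mul_comm]
  rw [sq, Finset.sum_mul_sum]
  refine h1.trans (le_of_eq ?_)
  simp only [Finset.sum_add_distrib, h2, Finset.sum_filter]
  rw [two_mul]

theorem lintegral_sq_sum_conv_le_of_measurable (S : Finset ℤ) {A A₂ : ℤ → Set (Rd d)}
    (hA : ∀ j, MeasurableSet (A j)) (hA₂ : ∀ j, MeasurableSet (A₂ j))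
    (hsub : ∀ i j, i ≤ j → ∀ u ∈ A j, ∀ w ∈ A i, u - w ∈ A₂ j)
    {f : ℤ → Rd d → ℝ≥0∞} (hf : ∀ j, Measurable (f j)) (c : ℤ → ℝ≥0∞)
    {K L : ℝ≥0∞} (hK : ∀ i, c i * volume (A i) ≤ K)
    (hL : ∀ j y, c j * ∑ i ∈ S with i ≤ j, ∫⁻ z in {z | z - y ∈ A₂ j}, f i z ≤ L) :
    ∫⁻ x, (∑ j ∈ S, c j * ∫⁻ y in {y | x - y ∈ A j}, f j y) ^ 2 ≤
      2 * K * L * ∑ j ∈ S, ∫⁻ y, f j y := by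
  have hmeas : ∀ j, Measurable fun x => ∫⁻ y in {y | x - y ∈ A j}, f j y :=
    fun j => measurable_lintegral_sub_mem (hA j) (hf j)
  have hmeas2 : ∀ i j, Measurable fun y => ∫⁻ z in {z | z - y ∈ A₂ j}, f i z :=
    fun i j => measurable_lintegral_sub_mem' (hA₂ j) (hf i)
  set I : ℤ → Rd d → ℝ≥0∞ := fun j x => ∫⁻ y in {y | x - y ∈ A j}, f j y
    with hI
  calc ∫⁻ x, (∑ j ∈ S, c j * I j x) ^ 2
      ≤ ∫⁻ x, 2 * ∑ j ∈ S, ∑ i ∈ S with i ≤ j, (c j * I j x) * (c i * I i x) :=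
        lintegral_mono fun x => sq_sum_le_two_mul_sum_filter_le S _
    _ = 2 * ∑ j ∈ S, ∑ i ∈ S with i ≤ j, ∫⁻ x, (c j * I j x) * (c i * I i x) := by
        have hm : ∀ i j, Measurable fun x => (c j * I j x) * (c i * I i x) := fun i j =>
          ((hmeas j).const_mul _).mul ((hmeas i).const_mul _)
        rw [lintegral_const_mul _ (Finset.measurable_fun_sum _ fun j _ =>
          Finset.measurable_fun_sum _ fun i _ => hm i j), lintegral_finsetSum _ (fun j _ =>
          Finset.measurable_fun_sum _ fun i _ => hm i j)]
        congr 1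
        exact Finset.sum_congr rfl fun j _ => lintegral_finsetSum _ fun i _ => hm i j
    _ ≤ 2 * ∑ j ∈ S, ∑ i ∈ S with i ≤ j,
        c j * K * ∫⁻ y, f j y * ∫⁻ z in {z | z - y ∈ A₂ j}, f i z := by
        refine mul_le_mul_right (Finset.sum_le_sum fun j _ => Finset.sum_le_sum fun i hi => ?_) _
        calc ∫⁻ x, (c j * I j x) * (c i * I i x)
            = c j * c i * ∫⁻ x, I j x * I i x := by
              rw [← lintegral_const_mul _ (show Measurable fun x => I j x * I i x from
                (hmeas j).mul (hmeas i))]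
              exact lintegral_congr fun x => by ring
          _ ≤ c j * c i * (volume (A i) * ∫⁻ y, f j y * ∫⁻ z in {z | z - y ∈ A₂ j}, f i z) :=
              mul_le_mul_right (lintegral_conv_mul_conv_le (hA j) (hA i) (hA₂ j)
                (hsub i j (Finset.mem_filter.1 hi).2) (hf j) (hf i)) _
          _ = c j * (c i * volume (A i)) * ∫⁻ y, f j y * ∫⁻ z in {z | z - y ∈ A₂ j}, f i z := by
              ring
          _ ≤ _ := by gcongr; exact hK i
    _ = 2 * ∑ j ∈ S, K * ∫⁻ y, f j y * (c j * ∑ i ∈ S with i ≤ j,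
          ∫⁻ z in {z | z - y ∈ A₂ j}, f i z) := by
        congr 1
        refine Finset.sum_congr rfl fun j _ => ?_
        have hm : ∀ i, Measurable fun y => f j y * ∫⁻ z in {z | z - y ∈ A₂ j}, f i z :=
          fun i => (hf j).mul (hmeas2 i j)
        rw [← Finset.mul_sum, ← lintegral_finsetSum _ (fun i _ => hm i),
          mul_comm (c j) K, mul_assoc, ← lintegral_const_mul _
            (Finset.measurable_fun_sum _ fun i _ => hm i)]
        congr 1
        refine lintegral_congr fun y => ?_
        rw [← Finset.mul_sum]
        ring
    _ ≤ 2 * ∑ j ∈ S, K * ∫⁻ y, f j y * L := by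
        gcongr with j _ y
        exact hL j y
    _ = _ := by
        simp only [lintegral_mul_const _ (hf _), Finset.mul_sum]
        exact Finset.sum_congr rfl fun j _ => by ring

theorem lintegral_sq_sum_conv_le (S : Finset ℤ) {A A₂ : ℤ → Set (Rd d)}
    (hA : ∀ j, MeasurableSet (A j)) (hA₂ : ∀ j, MeasurableSet (A₂ j))
    (hsub : ∀ i j, i ≤ j → ∀ u ∈ A j, ∀ w ∈ A i, u - w ∈ A₂ j)
    {f : ℤ → Rd d → ℝ≥0∞} (hf : ∀ j, AEMeasurable (f j)) (c : ℤ → ℝ≥0∞)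
    {K L : ℝ≥0∞} (hK : ∀ i, c i * volume (A i) ≤ K)
    (hL : ∀ j y, c j * ∑ i ∈ S with i ≤ j, ∫⁻ z in {z | z - y ∈ A₂ j}, f i z ≤ L) :
    ∫⁻ x, (∑ j ∈ S, c j * ∫⁻ y in {y | x - y ∈ A j}, f j y) ^ 2 ≤
      2 * K * L * ∑ j ∈ S, ∫⁻ y, f j y := by
  have hset : ∀ i (T : Set (Rd d)),
      ∫⁻ z in T, f i z = ∫⁻ z in T, (hf i).mk (f i) z := fun i T =>
    lintegral_congr_ae (ae_restrict_of_ae (hf i).ae_eq_mk)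
  have huniv : ∀ i, ∫⁻ z, f i z = ∫⁻ z, (hf i).mk (f i) z := fun i =>
    lintegral_congr_ae (hf i).ae_eq_mk
  simp only [hset, huniv] at hL ⊢
  exact lintegral_sq_sum_conv_le_of_measurable S hA hA₂ hsub (fun j => (hf j).measurable_mk) c hK hL

end

lemma volume_orthonormal_box {d : ℕ} (B : OrthonormalBasis (Fin d) ℝ (Rd d)) (w : Fin d → ℝ) :
    volume {x : Rd d | ∀ i, |⟪B i, x⟫| ≤ w i} = ∏ i, ENNReal.ofReal (2 * w i) := by
  have h1 : MeasurePreserving (fun x : Rd d => WithLp.ofLp (B.repr x)) volume volume :=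
    (PiLp.volume_preserving_ofLp (Fin d)).comp B.measurePreserving_repr
  have h2 : {x : Rd d | ∀ i, |⟪B i, x⟫| ≤ w i} =
      (fun x : Rd d => WithLp.ofLp (B.repr x)) ⁻¹' (Set.univ.pi fun i => Set.Icc (-w i) (w i)) := by
    ext x
    simp only [Set.mem_preimage, Set.mem_univ_pi, Set.mem_Icc, Set.mem_ofPred_eq, ← abs_le,
      B.repr_apply_apply]
  rw [h2, h1.measure_preimage
    (MeasurableSet.univ_pi fun i => measurableSet_Icc).nullMeasurableSet, volume_pi_pi]
  refine Finset.prod_congr rfl fun i _ => ?_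
  rw [Real.volume_Icc]
  congr 1
  ring

lemma measurableSet_orthonormal_box {d : ℕ} (B : OrthonormalBasis (Fin d) ℝ (Rd d))
    (w : Fin d → ℝ) : MeasurableSet {x : Rd d | ∀ i, |⟪B i, x⟫| ≤ w i} := by
  have : IsClosed {x : Rd d | ∀ i, |⟪B i, x⟫| ≤ w i} := by
    simp only [Set.ofPred_forall]
    refine isClosed_iInter fun i => isClosed_le ?_ continuous_const
    fun_prop
  exact this.measurableSet

/-- On the unit sphere, the largest coordinate is a Lipschitz function of the other ones. -/
lemma abs_sub_le_sum_erase {ι : Type*} [Fintype ι] [DecidableEq ι] {x y : ι → ℝ}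
    (hx : ∑ k, x k ^ 2 = 1) (hy : ∑ k, y k ^ 2 = 1) {i : ι}
    (hxi : ∀ k, |x k| ≤ |x i|) (hyi : ∀ k, |y k| ≤ |y i|) (hs : 0 ≤ x i ∧ 0 ≤ y i) :
    |x i - y i| ≤ ∑ k ∈ Finset.univ.erase i, |x k - y k| := by
  obtain ⟨hxs, hys⟩ := hs
  have hpos : 0 < x i + y i := by
    rcases hxs.lt_or_eq with h | h
    · linarith
    · exfalso
      have : ∀ k, x k = 0 := fun k => by
        have := hxi k
        rw [← h] at this
        simpa using this
      simp [this] at hx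
  have e1 : x i ^ 2 + ∑ k ∈ Finset.univ.erase i, x k ^ 2 = 1 := by
    rw [← hx, Finset.add_sum_erase _ (fun k => x k ^ 2) (Finset.mem_univ i)]
  have e2 : y i ^ 2 + ∑ k ∈ Finset.univ.erase i, y k ^ 2 = 1 := by
    rw [← hy, Finset.add_sum_erase _ (fun k => y k ^ 2) (Finset.mem_univ i)]
  have e3 : (x i - y i) * (x i + y i) = ∑ k ∈ Finset.univ.erase i, (y k ^ 2 - x k ^ 2) := by
    rw [Finset.sum_sub_distrib]; linarith
  have e4 : |x i - y i| * (x i + y i) ≤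
      (∑ k ∈ Finset.univ.erase i, |x k - y k|) * (x i + y i) := by
    calc |x i - y i| * (x i + y i) = |(x i - y i) * (x i + y i)| := by
          rw [abs_mul, abs_of_pos hpos]
      _ ≤ ∑ k ∈ Finset.univ.erase i, |y k ^ 2 - x k ^ 2| := by
          rw [e3]; exact Finset.abs_sum_le_sum_abs _ _
      _ ≤ ∑ k ∈ Finset.univ.erase i, |x k - y k| * (x i + y i) := by
          refine Finset.sum_le_sum fun k _ => ?_
          have : y k ^ 2 - x k ^ 2 = -((x k - y k) * (x k + y k)) := by ring
          rw [this, abs_neg, abs_mul]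
          refine mul_le_mul_of_nonneg_left ?_ (abs_nonneg _)
          have h1 := hxi k
          have h2 := hyi k
          rw [abs_of_nonneg hxs] at h1
          rw [abs_of_nonneg hys] at h2
          exact (abs_add_le _ _).trans (add_le_add h1 h2)
      _ = _ := by rw [Finset.sum_mul]
  exact le_of_mul_le_mul_right e4 hpos

lemma card_le_prod_of_nonneg {ι V : Type*} [Fintype ι] [DecidableEq ι]
    (S : Finset V) (x : V → ι → ℝ) {ρ : ℝ} (hρ : 0 < ρ) (i : ι) (β : ι → ℝ)
    (hunit : ∀ v ∈ S, ∑ k, x v k ^ 2 = 1)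
    (hsep : ∀ v ∈ S, ∀ v' ∈ S, v ≠ v' → ρ ≤ ∑ k, |x v k - x v' k|)
    (hmax : ∀ v ∈ S, ∀ k, |x v k| ≤ |x v i|) (hpos : ∀ v ∈ S, 0 ≤ x v i)
    (hβ : ∀ v ∈ S, ∀ k, k ≠ i → |x v k| ≤ β k) (hβ0 : ∀ k, 0 ≤ β k) :
    (S.card : ℝ) ≤ ∏ k, if k = i then 1 else (4 * Fintype.card ι * β k / ρ + 2) := by
  have hcard : 0 < (Fintype.card ι : ℝ) := by
    have := Fintype.card_pos_iff.2 ⟨i⟩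
    exact_mod_cast this
  set η : ℝ := ρ / (2 * Fintype.card ι) with hη
  have hη0 : 0 < η := by positivity
  let F : V → ι → ℤ := fun v k => if k = i then 0 else ⌊x v k / η⌋
  let T : ι → Finset ℤ := fun k => if k = i then {0} else Finset.Icc ⌊-β k / η⌋ ⌊β k / η⌋
  have hmap : ∀ v ∈ S, F v ∈ Fintype.piFinset T := by
    intro v hv
    rw [Fintype.mem_piFinset]
    intro k
    by_cases hk : k = i
    · simp [F, T, hk]
    · have := abs_le.1 (hβ v hv k hk)
      simp only [F, T, hk, if_false, Finset.mem_Icc]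
      exact ⟨Int.floor_le_floor (by gcongr; exact this.1),
        Int.floor_le_floor (by gcongr; exact this.2)⟩
  have hinj : Set.InjOn F S := by
    intro v hv v' hv' hF
    by_contra hne
    have h1 : ∀ k ∈ Finset.univ.erase i, |x v k - x v' k| ≤ η := by
      intro k hk
      have hk' := Finset.ne_of_mem_erase hk
      have h2 := congrFun hF k
      simp only [F, hk', if_false] at h2
      have h3 := (Int.abs_sub_lt_one_of_floor_eq_floor h2).le
      rw [← sub_div, abs_div, abs_of_pos hη0, div_le_one hη0] at h3
      exact h3
    have h2 := abs_sub_le_sum_erase (hunit v hv) (hunit v' hv') (hmax v hv) (hmax v' hv')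
      ⟨hpos v hv, hpos v' hv'⟩
    have h3 := hsep v hv v' hv' hne
    rw [← Finset.add_sum_erase _ (fun k => |x v k - x v' k|) (Finset.mem_univ i)] at h3
    have h4 := Finset.sum_le_sum h1
    rw [Finset.sum_const, Finset.card_erase_of_mem (Finset.mem_univ i), Finset.card_univ,
      nsmul_eq_mul, Nat.cast_sub (Fintype.card_pos_iff.2 ⟨i⟩)] at h4
    have h5 : ρ = 2 * (Fintype.card ι : ℝ) * η := by rw [hη]; field_simp
    push_cast at h4
    nlinarith
  have h1 := Finset.card_le_card_of_injOn F hmap hinj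
  rw [Fintype.card_piFinset] at h1
  have h2 : (S.card : ℝ) ≤ ∏ k, ((T k).card : ℝ) := by exact_mod_cast h1
  refine h2.trans (Finset.prod_le_prod (fun _ _ => by positivity) fun k _ => ?_)
  by_cases hk : k = i
  · simp [T, hk]
  · simp only [T, hk, if_false, Int.card_Icc]
    have h3 : (⌊β k / η⌋ : ℝ) ≤ β k / η := Int.floor_le _
    have h4 : -β k / η - 1 < (⌊-β k / η⌋ : ℝ) := Int.sub_one_lt_floor _
    have h5 : ((⌊β k / η⌋ + 1 - ⌊-β k / η⌋).toNat : ℝ)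
        = ((⌊β k / η⌋ + 1 - ⌊-β k / η⌋ : ℤ) : ℝ) := by
      have : ⌊-β k / η⌋ ≤ ⌊β k / η⌋ :=
        Int.floor_le_floor (by gcongr; linarith [hβ0 k])
      have h6 : ((⌊β k / η⌋ + 1 - ⌊-β k / η⌋).toNat : ℤ) = ⌊β k / η⌋ + 1 - ⌊-β k / η⌋ :=
        Int.toNat_of_nonneg (by lia)
      exact_mod_cast congrArg (fun z : ℤ => (z : ℝ)) h6
    rw [h5]
    push_cast
    have h6 : 4 * Fintype.card ι * β k / ρ = 2 * (β k / η) := by rw [hη]; field_simp; ring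
    rw [h6]
    have h7 : -β k / η = -(β k / η) := by ring
    linarith

lemma card_le_sum_prod {ι V : Type*} [Fintype ι] [DecidableEq ι] [Nonempty ι]
    (S : Finset V) (x : V → ι → ℝ) {ρ : ℝ} (hρ : 0 < ρ) (β : ι → ι → ℝ)
    (hunit : ∀ v ∈ S, ∑ k, x v k ^ 2 = 1)
    (hsep : ∀ v ∈ S, ∀ v' ∈ S, v ≠ v' → ρ ≤ ∑ k, |x v k - x v' k|)
    (hβ : ∀ v ∈ S, ∀ i, (∀ k, |x v k| ≤ |x v i|) → ∀ k, k ≠ i → |x v k| ≤ β i k)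
    (hβ0 : ∀ i k, 0 ≤ β i k) :
    (S.card : ℝ) ≤
      ∑ i, 2 * ∏ k, if k = i then 1 else (4 * Fintype.card ι * β i k / ρ + 2) := by
  classical
  have hex : ∀ v, ∃ i, ∀ k, |x v k| ≤ |x v i| := fun v => Finite.exists_max fun k => |x v k|
  let P : ι → Finset V := fun i => S.filter fun v => (∀ k, |x v k| ≤ |x v i|) ∧ 0 ≤ x v i
  let M : ι → Finset V := fun i => S.filter fun v => (∀ k, |x v k| ≤ |x v i|) ∧ x v i ≤ 0
  have hcov : S ⊆ Finset.univ.biUnion fun i => P i ∪ M i := by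
    intro v hv
    obtain ⟨i, hi⟩ := hex v
    simp only [Finset.mem_biUnion, Finset.mem_univ, true_and, Finset.mem_union, P, M,
      Finset.mem_filter]
    exact ⟨i, (le_total 0 (x v i)).imp (fun h => ⟨hv, hi, h⟩) fun h => ⟨hv, hi, h⟩⟩
  have h1 : S.card ≤ ∑ i, ((P i).card + (M i).card) :=
    (Finset.card_le_card hcov).trans (Finset.card_biUnion_le.trans
      (Finset.sum_le_sum fun i _ => Finset.card_union_le _ _))
  have h2 : (S.card : ℝ) ≤ ∑ i, (((P i).card : ℝ) + (M i).card) := by exact_mod_cast h1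
  refine h2.trans (Finset.sum_le_sum fun i _ => ?_)
  rw [two_mul]
  refine add_le_add ?_ ?_
  · refine card_le_prod_of_nonneg (P i) x hρ i (β i) ?_ ?_ ?_ ?_ ?_ (hβ0 i)
    · exact fun v hv => hunit v (Finset.mem_filter.1 hv).1
    · exact fun v hv v' hv' => hsep v (Finset.mem_filter.1 hv).1 v' (Finset.mem_filter.1 hv').1
    · exact fun v hv => (Finset.mem_filter.1 hv).2.1
    · exact fun v hv => (Finset.mem_filter.1 hv).2.2
    · exact fun v hv => hβ v (Finset.mem_filter.1 hv).1 i (Finset.mem_filter.1 hv).2.1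
  · refine card_le_prod_of_nonneg (M i) (fun v k => -x v k) hρ i (β i) ?_ ?_ ?_ ?_ ?_ (hβ0 i)
    · intro v hv
      simpa using hunit v (Finset.mem_filter.1 hv).1
    · intro v hv v' hv' hne
      refine (hsep v (Finset.mem_filter.1 hv).1 v' (Finset.mem_filter.1 hv').1 hne).trans_eq ?_
      refine Finset.sum_congr rfl fun k _ => ?_
      rw [abs_sub_comm]
      congr 1
      ring
    · intro v hv k
      simpa using (Finset.mem_filter.1 hv).2.1 k
    · intro v hv
      simpa using (Finset.mem_filter.1 hv).2.2
    · intro v hv k hk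
      simpa using hβ v (Finset.mem_filter.1 hv).1 i (Finset.mem_filter.1 hv).2.1 k hk

lemma exists_orthonormalBasis_of_norm_eq_one {d : ℕ} (i₀ : Fin d) {u : Rd d} (hu : ‖u‖ = 1) :
    ∃ B : OrthonormalBasis (Fin d) ℝ (Rd d), B i₀ = u := by
  have h : Orthonormal ℝ (({i₀} : Set (Fin d)).domRestrict fun _ : Fin d => u) := by
    rw [orthonormal_iff_ite]
    rintro ⟨i, rfl⟩ ⟨j, rfl⟩
    simp [hu]
  obtain ⟨B, hB⟩ := h.exists_orthonormalBasis_extension_of_card_eq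
    (by simp)
  exact ⟨B, hB i₀ rfl⟩

lemma norm_le_sum_abs_inner {d : ℕ} (B : OrthonormalBasis (Fin d) ℝ (Rd d)) (x : Rd d) :
    ‖x‖ ≤ ∑ k, |⟪B k, x⟫| := by
  conv_lhs => rw [← B.sum_repr' x]
  refine (norm_sum_le _ _).trans_eq (Finset.sum_congr rfl fun k _ => ?_)
  rw [norm_smul, B.norm_eq_one, mul_one, Real.norm_eq_abs]

lemma sum_inner_sq_eq_one {d : ℕ} (B : OrthonormalBasis (Fin d) ℝ (Rd d)) {x : Rd d}
    (hx : ‖x‖ = 1) : ∑ k, ⟪B k, x⟫ ^ 2 = 1 := by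
  have := B.sum_sq_norm_inner_right x
  simpa [hx] using this

/-- Number of `δ/16`-separated unit vectors. -/
lemma card_separated_le {d : ℕ} (hd : 2 ≤ d) {V : Type*} [Fintype V] (e : V → Rd d) {δ : ℝ}
    (hδ : 0 < δ) (hδ1 : δ ≤ 1) (he : ∀ v, ‖e v‖ = 1)
    (hsep : ∀ v v', v ≠ v' → δ / 16 ≤ ‖e v - e v'‖) :
    (Fintype.card V : ℝ) ≤ 2 * d * (258 * d) ^ d * δ⁻¹ ^ (d - 1) := by
  have : Nonempty (Fin d) := ⟨⟨0, by lia⟩⟩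
  let B := EuclideanSpace.basisFun (Fin d) ℝ
  have hd1 : (1:ℝ) ≤ d := by exact_mod_cast (by lia : 1 ≤ d)
  have h := card_le_sum_prod Finset.univ (fun v k => ⟪B k, e v⟫) (ρ := δ / 16) (by positivity)
    (fun _ _ => 1) (fun v _ => sum_inner_sq_eq_one B (he v))
    (fun v _ v' _ hne => by
      refine (hsep v v' hne).trans ((norm_le_sum_abs_inner B _).trans_eq ?_)
      simp only [inner_sub_right])
    (fun v _ i _ k _ => by
      refine (abs_real_inner_le_norm _ _).trans ?_
      rw [B.norm_eq_one, he, mul_one])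
    (fun _ _ => zero_le_one)
  rw [Finset.card_univ] at h
  refine h.trans ?_
  have hδi : 1 ≤ δ⁻¹ := (one_le_inv₀ hδ).2 hδ1
  have hterm : ∀ i : Fin d, (∏ k : Fin d, if k = i then (1:ℝ) else
      (4 * Fintype.card (Fin d) * 1 / (δ / 16) + 2)) ≤ (258 * d) ^ d * δ⁻¹ ^ (d - 1) := by
    intro i
    rw [← Finset.mul_prod_erase _ _ (Finset.mem_univ i), if_pos rfl, one_mul,
      Finset.prod_congr rfl (g := fun _ => 4 * (d:ℝ) * 1 / (δ / 16) + 2)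
        (fun k hk => by rw [if_neg (Finset.ne_of_mem_erase hk), Fintype.card_fin]),
      Finset.prod_const, Finset.card_erase_of_mem (Finset.mem_univ i), Finset.card_univ,
      Fintype.card_fin]
    have e1 : 4 * (d:ℝ) * 1 / (δ / 16) + 2 ≤ 258 * d * δ⁻¹ := by
      have : 4 * (d:ℝ) * 1 / (δ / 16) = 64 * (d * δ⁻¹) := by field_simp; norm_num
      rw [this]
      nlinarith
    calc (4 * (d:ℝ) * 1 / (δ / 16) + 2) ^ (d - 1) ≤ (258 * d * δ⁻¹) ^ (d - 1) := by gcongr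
      _ = (258 * d) ^ (d - 1) * δ⁻¹ ^ (d - 1) := mul_pow _ _ _
      _ ≤ _ := by
        gcongr
        · linarith
        · lia
  calc _ ≤ ∑ i : Fin d, 2 * ((258 * (d:ℝ)) ^ d * δ⁻¹ ^ (d - 1)) :=
        Finset.sum_le_sum fun i _ => mul_le_mul_of_nonneg_left (hterm i) zero_le_two
    _ = _ := by
        rw [Finset.sum_const, Finset.card_univ, Fintype.card_fin, nsmul_eq_mul]; ring

/-- Number of `δ/16`-separated unit vectors almost orthogonal to a given direction. -/
lemma card_separated_equator_le {d : ℕ} (hd : 2 ≤ d) {V : Type*} (e : V → Rd d) {δ : ℝ}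
    (hδ : 0 < δ) (hδ1 : δ ≤ 1) (he : ∀ v, ‖e v‖ = 1)
    (hsep : ∀ v v', v ≠ v' → δ / 16 ≤ ‖e v - e v'‖) {u : Rd d} (hu : ‖u‖ = 1)
    (S : Finset V) (hS : ∀ v ∈ S, |⟪u, e v⟫| ≤ 4 * δ) :
    (S.card : ℝ) ≤ 2 * d * (258 * d) ^ d * δ⁻¹ ^ (d - 2) := by
  let i₀ : Fin d := ⟨0, by lia⟩
  have : Nonempty (Fin d) := ⟨i₀⟩
  obtain ⟨B, hB⟩ := exists_orthonormalBasis_of_norm_eq_one i₀ hu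
  have hd1 : (1:ℝ) ≤ d := by exact_mod_cast (by lia : 1 ≤ d)
  have h := card_le_sum_prod S (fun v k => ⟪B k, e v⟫) (ρ := δ / 16) (by positivity)
    (fun i k => if i = i₀ ∨ k = i₀ then 4 * δ else 1)
    (fun v _ => sum_inner_sq_eq_one B (he v))
    (fun v _ v' _ hne => by
      refine (hsep v v' hne).trans ((norm_le_sum_abs_inner B _).trans_eq ?_)
      simp only [inner_sub_right])
    (fun v hv i hi k _ => by
      have hv' := hS v hv
      rw [← hB] at hv'
      by_cases h1 : i = i₀
      · subst h1
        simpa using (hi k).trans hv'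
      · by_cases h2 : k = i₀
        · subst h2
          simpa using hv'
        · simp only [h1, h2, or_self, if_false]
          refine (abs_real_inner_le_norm _ _).trans ?_
          rw [B.norm_eq_one, he, mul_one])
    (fun i k => by positivity)
  refine h.trans ?_
  have hδi : 1 ≤ δ⁻¹ := (one_le_inv₀ hδ).2 hδ1
  have e1 : 4 * (d:ℝ) * 1 / (δ / 16) + 2 ≤ 258 * d * δ⁻¹ := by
    have : 4 * (d:ℝ) * 1 / (δ / 16) = 64 * (d * δ⁻¹) := by field_simp; norm_num
    rw [this]
    nlinarith
  have e2 : 4 * (d:ℝ) * (4 * δ) / (δ / 16) + 2 ≤ 258 * d := by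
    have : 4 * (d:ℝ) * (4 * δ) / (δ / 16) = 256 * d := by field_simp; norm_num
    rw [this]
    linarith
  have hbig : (1:ℝ) ≤ 258 * d := by linarith
  have hterm : ∀ i : Fin d, (∏ k : Fin d, if k = i then (1:ℝ) else
      (4 * Fintype.card (Fin d) * (if i = i₀ ∨ k = i₀ then 4 * δ else 1) / (δ / 16) + 2)) ≤
      (258 * d) ^ d * δ⁻¹ ^ (d - 2) := by
    intro i
    have hfac : ∀ k : Fin d, (if k = i then (1:ℝ) else
        (4 * Fintype.card (Fin d) * (if i = i₀ ∨ k = i₀ then 4 * δ else 1) / (δ / 16) + 2)) ≤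
        258 * d * (if k = i ∨ i = i₀ ∨ k = i₀ then 1 else δ⁻¹) := by
      intro k
      rw [Fintype.card_fin]
      by_cases h1 : k = i
      · simpa [h1] using hbig
      · by_cases h2 : i = i₀ ∨ k = i₀
        · simpa [h1, h2] using e2
        · simpa [h1, h2] using e1
    refine (Finset.prod_le_prod (fun k _ => by positivity) fun k _ => hfac k).trans ?_
    rw [Finset.prod_mul_distrib, Finset.prod_const, Finset.card_univ, Fintype.card_fin]
    refine mul_le_mul_of_nonneg_left ?_ (by positivity)
    rw [Finset.prod_ite, Finset.prod_const_one, one_mul, Finset.prod_const]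
    by_cases h1 : i = i₀
    · simpa [h1] using one_le_pow₀ hδi
    · refine pow_le_pow_right₀ hδi ?_
      have hsub : Finset.univ.filter (fun k => ¬ (k = i ∨ i = i₀ ∨ k = i₀)) ⊆
          (Finset.univ.erase i).erase i₀ := by
        intro k
        simp only [Finset.mem_filter, Finset.mem_erase, Finset.mem_univ, true_and, and_true]
        tauto
      refine (Finset.card_le_card hsub).trans_eq ?_
      rw [Finset.card_erase_of_mem (by simp [Ne.symm h1]),
        Finset.card_erase_of_mem (Finset.mem_univ i), Finset.card_univ, Fintype.card_fin]
      lia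
  calc _ ≤ ∑ i : Fin d, 2 * ((258 * (d:ℝ)) ^ d * δ⁻¹ ^ (d - 2)) :=
        Finset.sum_le_sum fun i _ => mul_le_mul_of_nonneg_left (hterm i) zero_le_two
    _ = _ := by
        rw [Finset.sum_const, Finset.card_univ, Fintype.card_fin, nsmul_eq_mul]; ring

lemma dcube_eq_preimage {d : ℕ} (k : ℤ) (m : Fin d → ℤ) :
    dcube d 0 k m = (fun x : Rd d => WithLp.ofLp x) ⁻¹'
      (Set.univ.pi fun i => Set.Ico ((2:ℝ) ^ k * m i) ((2:ℝ) ^ k * (m i + 1))) := by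
  ext x
  simp [dcube, Set.mem_pi]

lemma volume_dcube {d : ℕ} (k : ℤ) (m : Fin d → ℤ) :
    volume (dcube d 0 k m) = ENNReal.ofReal ((2:ℝ) ^ k) ^ d := by
  rw [dcube_eq_preimage, (PiLp.volume_preserving_ofLp (Fin d)).measure_preimage
    (MeasurableSet.univ_pi fun i => measurableSet_Ico).nullMeasurableSet, volume_pi_pi]
  simp only [Real.volume_Ico]
  rw [Finset.prod_congr rfl (g := fun _ => ENNReal.ofReal ((2:ℝ) ^ k))
    fun i _ => by congr 1; ring]
  simp

lemma volume_interior_dcube {d : ℕ} (k : ℤ) (m : Fin d → ℤ) :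
    volume (interior (dcube d 0 k m)) = volume (dcube d 0 k m) := by
  refine le_antisymm (measure_mono interior_subset) ?_
  have hopen : IsOpen ((fun x : Rd d => WithLp.ofLp x) ⁻¹'
      (Set.univ.pi fun i => Set.Ioo ((2:ℝ) ^ k * m i) ((2:ℝ) ^ k * (m i + 1)))) :=
    (isOpen_set_pi Set.finite_univ fun i _ => isOpen_Ioo).preimage
      (PiLp.continuous_ofLp 2 _)
  have hsub : ((fun x : Rd d => WithLp.ofLp x) ⁻¹'
      (Set.univ.pi fun i => Set.Ioo ((2:ℝ) ^ k * m i) ((2:ℝ) ^ k * (m i + 1)))) ⊆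
      interior (dcube d 0 k m) := by
    refine interior_maximal ?_ hopen
    rw [dcube_eq_preimage]
    exact Set.preimage_mono (Set.pi_mono fun i _ => Set.Ioo_subset_Ico_self)
  refine le_trans (le_of_eq ?_) (measure_mono hsub)
  rw [volume_dcube, (PiLp.volume_preserving_ofLp (Fin d)).measure_preimage
    (MeasurableSet.univ_pi fun i => measurableSet_Ioo).nullMeasurableSet, volume_pi_pi]
  simp only [Real.volume_Ioo]
  rw [Finset.prod_congr rfl (g := fun _ => ENNReal.ofReal ((2:ℝ) ^ k))
    fun i _ => by congr 1; ring]
  simp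

lemma norm_sub_le_of_mem_dcube {d : ℕ} {k : ℤ} {m : Fin d → ℤ} {x y : Rd d}
    (hx : x ∈ dcube d 0 k m) (hy : y ∈ dcube d 0 k m) : ‖x - y‖ ≤ d * (2:ℝ) ^ k := by
  refine (norm_le_sum_abs_inner (EuclideanSpace.basisFun (Fin d) ℝ) _).trans ?_
  calc _ ≤ ∑ _i : Fin d, (2:ℝ) ^ k := by
        refine Finset.sum_le_sum fun i _ => ?_
        rw [EuclideanSpace.basisFun_inner, abs_le]
        have h1 := hx i
        have h2 := hy i
        simp only [PiLp.sub_apply]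
        constructor <;> nlinarith
    _ = _ := by simp

/-- The sum of the absolute values of the bad functions at scale `2 ^ k`. -/
def absBsum (d : ℕ) (Qset : Set (ℤ × (Fin d → ℤ))) (b : ℤ × (Fin d → ℤ) → Rd d → ℝ)
    (k : ℤ) (x : Rd d) : ℝ≥0∞ :=
  ∑' mv : Fin d → ℤ, Set.indicator Qset (fun q => ‖b q x‖ₑ) (k, mv)

lemma enorm_bsum_le {d : ℕ} (Qset : Set (ℤ × (Fin d → ℤ))) (b : ℤ × (Fin d → ℤ) → Rd d → ℝ)
    (k : ℤ) (x : Rd d) : ‖bsum d Qset b k x‖ₑ ≤ absBsum d Qset b k x := by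
  refine enorm_tsum_le_tsum_enorm.trans (ENNReal.tsum_le_tsum fun mv => le_of_eq ?_)
  by_cases h : (k, mv) ∈ Qset <;> simp [h]

lemma aemeasurable_indicator_enorm {d : ℕ} {Qset : Set (ℤ × (Fin d → ℤ))}
    {b : ℤ × (Fin d → ℤ) → Rd d → ℝ} (hb : ∀ q ∈ Qset, Integrable (b q))
    (q : ℤ × (Fin d → ℤ)) : AEMeasurable fun x => Set.indicator Qset (fun q => ‖b q x‖ₑ) q := by
  by_cases h : q ∈ Qset
  · simpa [h] using (hb q h).1.enorm
  · simp [h]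

lemma aemeasurable_absBsum {d : ℕ} {Qset : Set (ℤ × (Fin d → ℤ))}
    {b : ℤ × (Fin d → ℤ) → Rd d → ℝ} (hb : ∀ q ∈ Qset, Integrable (b q)) (k : ℤ) :
    AEMeasurable (absBsum d Qset b k) :=
  AEMeasurable.tsum fun mv => aemeasurable_indicator_enorm hb (k, mv)

lemma sum_tsum_shift_le {M : Type*} (S : Finset ℤ) (s : ℤ) (f : ℤ × M → ℝ≥0∞) :
    ∑ j ∈ S, ∑' mv, f (j - s, mv) ≤ ∑' q, f q := by
  calc ∑ j ∈ S, ∑' mv, f (j - s, mv) ≤ ∑' j : ℤ, ∑' mv, f (j - s, mv) :=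
        ENNReal.sum_le_tsum S
    _ = ∑' j : ℤ, ∑' mv, f (j, mv) :=
        (Equiv.subRight s).tsum_eq fun j => ∑' mv, f (j, mv)
    _ = ∑' q, f q := ENNReal.tsum_prod.symm

lemma sum_lintegral_absBsum_le {d : ℕ} {Qset : Set (ℤ × (Fin d → ℤ))}
    {b : ℤ × (Fin d → ℤ) → Rd d → ℝ} (hb : ∀ q ∈ Qset, Integrable (b q)) (S : Finset ℤ) (s : ℤ) :
    ∑ j ∈ S, ∫⁻ x, absBsum d Qset b (j - s) x ≤
      ∑' q : Qset, ENNReal.ofReal (∫ x, |b q.1 x|) := by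
  have h1 : ∀ j ∈ S, ∫⁻ x, absBsum d Qset b (j - s) x =
      ∑' mv, Set.indicator Qset (fun q => ENNReal.ofReal (∫ x, |b q x|)) (j - s, mv) := by
    intro j _
    unfold absBsum
    rw [lintegral_tsum fun mv => aemeasurable_indicator_enorm hb _]
    refine tsum_congr fun mv => ?_
    by_cases h : (j - s, mv) ∈ Qset
    · simp only [h, Set.indicator_of_mem]
      exact (ofReal_integral_norm_eq_lintegral_enorm (hb _ h)).symm
    · simp [h]
  rw [Finset.sum_congr rfl h1, tsum_subtype Qset fun q => ENNReal.ofReal (∫ x, |b q x|)]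
  exact sum_tsum_shift_le S s _

/-- The bad functions of scale at most `2 ^ n` meeting `T` have mass at most `α |U|`, if `U`
contains all the corresponding cubes. -/
lemma sum_setLIntegral_absBsum_le {d : ℕ} {Qset : Set (ℤ × (Fin d → ℤ))}
    {b : ℤ × (Fin d → ℤ) → Rd d → ℝ} {α : ℝ} (hα : 0 ≤ α) (hB : BadFam d Qset b α)
    (S : Finset ℤ) (s n : ℤ) (hS : ∀ j ∈ S, j - s ≤ n) {T U : Set (Rd d)} (hT : MeasurableSet T)
    (hU : ∀ q ∈ Qset, q.1 ≤ n → (dcube d 0 q.1 q.2 ∩ T).Nonempty → dcube d 0 q.1 q.2 ⊆ U) :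
    ∑ j ∈ S, ∫⁻ x in T, absBsum d Qset b (j - s) x ≤ ENNReal.ofReal α * volume U := by
  classical
  obtain ⟨hdisj, hsupp, hint, hl1⟩ := hB
  let W : ℤ × (Fin d → ℤ) → Set (Rd d) := fun q =>
    if q ∈ Qset ∧ q.1 ≤ n ∧ (dcube d 0 q.1 q.2 ∩ T).Nonempty then interior (dcube d 0 q.1 q.2)
    else ∅
  have hWmeas : ∀ q, MeasurableSet (W q) := by
    intro q
    simp only [W]
    split_ifs
    · exact isOpen_interior.measurableSet
    · exact MeasurableSet.empty
  have hWdisj : Pairwise (Function.onFun Disjoint W) := by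
    intro q q' hne
    simp only [Function.onFun, W]
    split_ifs with h1 h2
    · exact hdisj h1.1 h2.1 hne
    all_goals simp
  have hWU : (⋃ q, W q) ⊆ U := by
    refine Set.iUnion_subset fun q => ?_
    simp only [W]
    split_ifs with h
    · exact interior_subset.trans (hU q h.1 h.2.1 h.2.2)
    · exact Set.empty_subset _
  have h1 : ∀ j ∈ S, ∫⁻ x in T, absBsum d Qset b (j - s) x ≤
      ∑' mv, ENNReal.ofReal α * volume (W (j - s, mv)) := by
    intro j hj
    unfold absBsum
    rw [lintegral_tsum fun mv => (aemeasurable_indicator_enorm hint _).restrict]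
    refine ENNReal.tsum_le_tsum fun mv => ?_
    by_cases h : (j - s, mv) ∈ Qset
    · simp only [h, Set.indicator_of_mem]
      by_cases hne : (dcube d 0 (j - s) mv ∩ T).Nonempty
      · have hW : W (j - s, mv) = interior (dcube d 0 (j - s) mv) := if_pos ⟨h, hS j hj, hne⟩
        rw [hW, volume_interior_dcube]
        refine (setLIntegral_le_lintegral _ _).trans ?_
        rw [← ofReal_integral_norm_eq_lintegral_enorm (hint _ h)]
        refine (ENNReal.ofReal_le_ofReal (hl1 _ h)).trans_eq ?_
        rw [ENNReal.ofReal_mul hα, ENNReal.ofReal_toReal]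
        rw [volume_dcube]
        exact ENNReal.pow_ne_top ENNReal.ofReal_ne_top
      · have hz : ∫⁻ x in T, ‖b (j - s, mv) x‖ₑ = ∫⁻ x in T, 0 := by
          refine setLIntegral_congr_fun hT fun x hx => ?_
          have : x ∉ Function.support (b (j - s, mv)) := fun hxs => hne ⟨x, hsupp _ h hxs, hx⟩
          simp [Function.notMem_support.1 this]
        rw [hz]
        simp
    · simp [h]
  calc _ ≤ ∑ j ∈ S, ∑' mv, ENNReal.ofReal α * volume (W (j - s, mv)) := Finset.sum_le_sum h1
    _ ≤ ∑' q, ENNReal.ofReal α * volume (W q) :=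
        sum_tsum_shift_le S s fun q => ENNReal.ofReal α * volume (W q)
    _ = ENNReal.ofReal α * volume (⋃ q, W q) := by
        rw [ENNReal.tsum_mul_left, measure_iUnion hWdisj hWmeas]
    _ ≤ _ := by gcongr

/-- The rectangular plate of dimensions `r` in the direction `B i₀` and `δ r` in the others. -/
def plate {d : ℕ} (B : OrthonormalBasis (Fin d) ℝ (Rd d)) (i₀ : Fin d) (δ r : ℝ) : Set (Rd d) :=
  {x | ∀ i, |⟪B i, x⟫| ≤ (if i = i₀ then 1 else δ) * r}

lemma measurableSet_plate {d : ℕ} (B : OrthonormalBasis (Fin d) ℝ (Rd d)) (i₀ : Fin d)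
    (δ r : ℝ) : MeasurableSet (plate B i₀ δ r) :=
  measurableSet_orthonormal_box B _

lemma volume_plate {d : ℕ} (B : OrthonormalBasis (Fin d) ℝ (Rd d)) (i₀ : Fin d) {δ r : ℝ}
    (hδ : 0 ≤ δ) (hr : 0 ≤ r) :
    volume (plate B i₀ δ r) = ENNReal.ofReal ((2 * r) ^ d * δ ^ (d - 1)) := by
  have h := volume_orthonormal_box B fun i => (if i = i₀ then 1 else δ) * r
  rw [plate, h, ← ENNReal.ofReal_prod_of_nonneg fun i _ => by positivity]
  congr 1
  have : ∀ i : Fin d, 2 * ((if i = i₀ then 1 else δ) * r) =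
      (2 * r) * (if i = i₀ then 1 else δ) := fun i => by ring
  simp only [this]
  rw [Finset.prod_mul_distrib, Finset.prod_const, Finset.card_univ, Fintype.card_fin,
    ← Finset.mul_prod_erase _ _ (Finset.mem_univ i₀), if_pos rfl, one_mul,
    Finset.prod_congr rfl (g := fun _ => δ)
      (fun k hk => by rw [if_neg (Finset.ne_of_mem_erase hk)]),
    Finset.prod_const, Finset.card_erase_of_mem (Finset.mem_univ i₀), Finset.card_univ,
    Fintype.card_fin]

lemma sub_mem_plate {d : ℕ} {B : OrthonormalBasis (Fin d) ℝ (Rd d)} {i₀ : Fin d} {δ r r' : ℝ}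
    (hδ : 0 ≤ δ) (hr : r' ≤ r) {u w : Rd d} (hu : u ∈ plate B i₀ δ r)
    (hw : w ∈ plate B i₀ δ r') : u - w ∈ plate B i₀ δ (2 * r) := by
  intro i
  rw [inner_sub_right]
  have h1 := hu i
  have h2 := hw i
  have h3 : (if i = i₀ then 1 else δ) * r' ≤ (if i = i₀ then 1 else δ) * r := by gcongr
  exact (abs_sub _ _).trans (by linarith)

lemma add_mem_plate {d : ℕ} {B : OrthonormalBasis (Fin d) ℝ (Rd d)} {i₀ : Fin d} {δ r r' : ℝ}
    (hδ1 : δ ≤ 1) (hr' : 0 ≤ r') {u w : Rd d} (hu : u ∈ plate B i₀ δ r)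
    (hw : ‖w‖ ≤ δ * r') : u + w ∈ plate B i₀ δ (r + r') := by
  intro i
  rw [inner_add_right]
  have h1 := hu i
  have h2 : |⟪B i, w⟫| ≤ ‖w‖ := by simpa using abs_real_inner_le_norm (B i) w
  have h3 : δ * r' ≤ (if i = i₀ then 1 else δ) * r' := by
    gcongr
    split_ifs <;> simp [hδ1]
  exact (abs_add_le _ _).trans (by linarith)

lemma mem_plate_of_norm_sub_le {d : ℕ} {B : OrthonormalBasis (Fin d) ℝ (Rd d)} {i₀ : Fin d}
    {δ r : ℝ} (hδ : 0 ≤ δ) {x : Rd d} (hx : ‖x‖ ≤ r) (h : ‖‖x‖⁻¹ • x - B i₀‖ ≤ δ) :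
    x ∈ plate B i₀ δ r := by
  intro i
  by_cases hi : i = i₀
  · rw [if_pos hi, one_mul]
    exact (by simpa using abs_real_inner_le_norm (B i) x : |⟪B i, x⟫| ≤ ‖x‖).trans hx
  · rw [if_neg hi]
    rcases eq_or_ne x 0 with rfl | hx0
    · simpa using mul_nonneg hδ (by simpa using hx)
    have hn : ‖x‖ ≠ 0 := norm_ne_zero_iff.2 hx0
    have h1 : ⟪B i, x⟫ = ‖x‖ * ⟪B i, ‖x‖⁻¹ • x - B i₀⟫ := by
      rw [inner_sub_right, B.inner_eq_zero hi, inner_smul_right]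
      field_simp
      simp
    have h2 : |⟪B i, ‖x‖⁻¹ • x - B i₀⟫| ≤ ‖‖x‖⁻¹ • x - B i₀‖ := by
      simpa using abs_real_inner_le_norm (B i) (‖x‖⁻¹ • x - B i₀)
    rw [h1, abs_mul, abs_norm, mul_comm]
    exact mul_le_mul (h2.trans h) hx (norm_nonneg _) hδ

lemma abs_Kv_le {d : ℕ} {φ Om : Rd d → ℝ} {Cφ Mb δ : ℝ} (hφ : AdmissiblePhi d φ)
    (hC : ∀ x, |φ x| ≤ Cφ) (hMb : ∀ x : Rd d, x ≠ 0 → |Om x| ≤ Mb) {E : Set (Rd d)}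
    (hE : E ⊆ Metric.sphere 0 1) (hδ : 0 ≤ δ) (hdiam : Metric.diam E ≤ δ)
    {B : OrthonormalBasis (Fin d) ℝ (Rd d)} {i₀ : Fin d} (hB : B i₀ ∈ E) (j : ℤ) (x : Rd d) :
    |Kv d φ Om E j x| ≤
      (plate B i₀ δ ((2:ℝ) ^ j)).indicator (fun _ => Cφ * Mb * (16 * (2:ℝ) ^ (-j)) ^ d) x := by
  by_cases h0 : Kv d φ Om E j x = 0
  · rw [h0, abs_zero]
    by_cases hx : x ∈ plate B i₀ δ ((2:ℝ) ^ j)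
    · rw [Set.indicator_of_mem hx]
      have h1 : 0 ≤ Cφ := (abs_nonneg _).trans (hC 0)
      have h2 : 0 ≤ Mb := (abs_nonneg _).trans (hMb (B i₀) (B.toBasis.ne_zero i₀ ∘ by simp))
      positivity
    · rw [Set.indicator_of_notMem hx]
  unfold Kv Kker at h0 ⊢
  have hφ0 : φ ((2:ℝ) ^ (-j) • x) ≠ 0 := fun h => h0 (by rw [h]; simp)
  have hxE : ‖x‖⁻¹ • x ∈ E := by
    by_contra h
    exact h0 (by simp [h])
  have hs := hφ.2.1 (subset_tsupport _ (Function.mem_support.2 hφ0))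
  obtain ⟨hs1, hs2⟩ := hs
  rw [norm_smul, norm_zpow, Real.norm_ofNat] at hs1 hs2
  have h2j : (0:ℝ) < (2:ℝ) ^ j := by positivity
  have hinv : (2:ℝ) ^ (-j) * (2:ℝ) ^ j = 1 := by rw [← zpow_add₀ two_ne_zero]; simp
  have h2j' : (0:ℝ) < (2:ℝ) ^ (-j) := by positivity
  have hup : ‖x‖ ≤ (2:ℝ) ^ j := by
    have : (2:ℝ) ^ (-j) * ‖x‖ ≤ (2:ℝ) ^ (-j) * (2:ℝ) ^ j := by
      rw [hinv]
      refine hs2.le.trans (by norm_num)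
    exact le_of_mul_le_mul_left this h2j'
  have hlow : (16 * (2:ℝ) ^ (-j))⁻¹ ≤ ‖x‖ := by
    rw [inv_le_iff_one_le_mul₀ (by positivity)]
    have : (2:ℝ) ^ (-4 : ℤ) = 1 / 16 := by norm_num
    rw [this] at hs1
    linarith
  have hxpos : 0 < ‖x‖ := lt_of_lt_of_le (by positivity) hlow
  have hx0 : x ≠ 0 := norm_pos_iff.1 hxpos
  have hmem : x ∈ plate B i₀ δ ((2:ℝ) ^ j) := by
    refine mem_plate_of_norm_sub_le hδ hup ?_
    rw [← dist_eq_norm]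
    exact (Metric.dist_le_diam_of_mem (Metric.isBounded_sphere.subset hE) hxE hB).trans hdiam
  rw [Set.indicator_of_mem hmem, Set.indicator_of_mem hxE, mul_one, abs_mul, abs_mul]
  have h1 : 0 ≤ Cφ := (abs_nonneg _).trans (hC 0)
  have h3 : |‖x‖ ^ (-(d:ℤ))| ≤ (16 * (2:ℝ) ^ (-j)) ^ d := by
    rw [abs_of_pos (by positivity), zpow_neg, zpow_natCast, ← inv_pow]
    gcongr
    rwa [inv_le_comm₀ hxpos (by positivity)]
  have h2 : 0 ≤ Mb := (abs_nonneg _).trans (hMb x hx0)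
  gcongr
  · exact hC _
  · exact hMb x hx0

lemma enorm_integral_mul_le {d : ℕ} {A : Set (Rd d)} (hA : MeasurableSet A) {k g : Rd d → ℝ}
    {c : ℝ} (hk : ∀ x, |k x| ≤ A.indicator (fun _ => c) x) {β : Rd d → ℝ≥0∞}
    (hg : ∀ y, ‖g y‖ₑ ≤ β y) (x : Rd d) :
    ‖∫ y, k (x - y) * g y‖ₑ ≤ ENNReal.ofReal c * ∫⁻ y in {y | x - y ∈ A}, β y := by
  refine (enorm_integral_le_lintegral_enorm _).trans ?_
  rw [lintegral_indicator_sub_mul hA, ← lintegral_const_mul' _ _ ENNReal.ofReal_ne_top]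
  refine lintegral_mono fun y => ?_
  rw [enorm_mul, ← mul_assoc]
  refine mul_le_mul' ?_ (hg y)
  have h := hk (x - y)
  by_cases hy : x - y ∈ A
  · rw [Set.indicator_of_mem hy] at h ⊢
    simpa [← ofReal_norm] using ENNReal.ofReal_le_ofReal h
  · rw [Set.indicator_of_notMem hy] at h ⊢
    simp [abs_nonpos_iff.1 h]

lemma lintegral_enorm_tsum_sq_le {α ι : Type*} [MeasurableSpace α] [Countable ι] {μ : Measure α}
    {F : ι → α → ℂ} {M : ℝ≥0∞} (hF : ∀ S : Finset ι, Measurable fun x => ∑ j ∈ S, F j x)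
    (hM : ∀ S : Finset ι, ∫⁻ x, ‖∑ j ∈ S, F j x‖ₑ ^ 2 ∂μ ≤ M) :
    ∫⁻ x, ‖∑' j, F j x‖ₑ ^ 2 ∂μ ≤ M := by
  have hpt : ∀ x, ‖∑' j, F j x‖ₑ ^ 2 ≤
      Filter.liminf (fun S : Finset ι => ‖∑ j ∈ S, F j x‖ₑ ^ 2) Filter.atTop := by
    intro x
    by_cases h : Summable fun j => F j x
    · refine le_of_eq (Filter.Tendsto.liminf_eq ?_).symm
      exact (ENNReal.continuous_pow 2).continuousAt.tendsto.comp h.hasSum.enorm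
    · simp [tsum_eq_zero_of_not_summable h]
  calc _ ≤ ∫⁻ x, Filter.liminf (fun S : Finset ι => ‖∑ j ∈ S, F j x‖ₑ ^ 2) Filter.atTop ∂μ :=
        lintegral_mono hpt
    _ ≤ Filter.liminf (fun S : Finset ι => ∫⁻ x, ‖∑ j ∈ S, F j x‖ₑ ^ 2 ∂μ) Filter.atTop :=
        lintegral_liminf_le fun S => (hF S).enorm.pow_const 2
    _ ≤ M := Filter.liminf_le_of_le (by isBoundedDefault) fun b hb => by
        obtain ⟨S, hS⟩ := hb.exists
        exact hS.trans (hM S)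

lemma lintegral_sq_sum_plate_le {d : ℕ} {s : ℕ} {δ : ℝ} (hδs : (2:ℝ) ^ (-(s:ℤ)) ≤ δ)
    (hδ1 : δ ≤ 1) {Qset : Set (ℤ × (Fin d → ℤ))} {b : ℤ × (Fin d → ℤ) → Rd d → ℝ} {α : ℝ}
    (hα : 0 ≤ α) (hB : BadFam d Qset b α) (B : OrthonormalBasis (Fin d) ℝ (Rd d)) (i₀ : Fin d)
    {a : ℝ} (ha : 0 ≤ a) (S : Finset ℤ) :
    ∫⁻ x, (∑ j ∈ S, ENNReal.ofReal (a * (16 * (2:ℝ) ^ (-j)) ^ d) *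
      ∫⁻ y in {y | x - y ∈ plate B i₀ δ ((2:ℝ) ^ j)}, absBsum d Qset b (j - s) y) ^ 2 ≤
    2 * ENNReal.ofReal (a * 32 ^ d * δ ^ (d - 1)) *
      ENNReal.ofReal (a * α * (32 * (d + 2)) ^ d * δ ^ (d - 1)) *
      ∑' q : Qset, ENNReal.ofReal (∫ x, |b q.1 x|) := by
  have hδ : 0 ≤ δ := le_trans (by positivity) hδs
  have hinv : ∀ j : ℤ, (2:ℝ) ^ (-j) * (2:ℝ) ^ j = 1 := fun j => by
    rw [← zpow_add₀ two_ne_zero]; simp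
  refine (lintegral_sq_sum_conv_le S (A₂ := fun j => plate B i₀ δ (2 * (2:ℝ) ^ j))
    (fun j => measurableSet_plate B i₀ δ _) (fun j => measurableSet_plate B i₀ δ _)
    (fun i j hij u hu w hw => sub_mem_plate hδ (zpow_le_zpow_right₀ one_le_two hij) hu hw)
    (f := fun j => absBsum d Qset b (j - s)) (fun j => aemeasurable_absBsum hB.2.2.1 _)
    (fun j => ENNReal.ofReal (a * (16 * (2:ℝ) ^ (-j)) ^ d))
    (K := ENNReal.ofReal (a * 32 ^ d * δ ^ (d - 1)))
    (L := ENNReal.ofReal (a * α * (32 * (d + 2)) ^ d * δ ^ (d - 1))) ?_ ?_).trans ?_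
  · intro i
    rw [volume_plate B i₀ hδ (by positivity), ← ENNReal.ofReal_mul (by positivity)]
    refine ENNReal.ofReal_le_ofReal (le_of_eq ?_)
    calc _ = a * (32 * ((2:ℝ) ^ (-i) * (2:ℝ) ^ i)) ^ d * δ ^ (d - 1) := by
          rw [← mul_assoc, mul_assoc a, ← mul_pow]
          congr 3
          ring
      _ = _ := by rw [hinv, mul_one]
  · intro j y
    have hvol : volume ((fun z => z - y) ⁻¹' plate B i₀ δ (2 * (2:ℝ) ^ j + d * (2:ℝ) ^ j)) =
        ENNReal.ofReal ((2 * (2 * (2:ℝ) ^ j + d * (2:ℝ) ^ j)) ^ d * δ ^ (d - 1)) := by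
      rw [← volume_plate B i₀ hδ (by positivity)]
      simp only [sub_eq_add_neg]
      exact measure_preimage_add_right _ _ _
    have hT : MeasurableSet {z : Rd d | z - y ∈ plate B i₀ δ (2 * (2:ℝ) ^ j)} :=
      (measurable_id.sub_const y) (measurableSet_plate B i₀ δ _)
    have h := sum_setLIntegral_absBsum_le hα hB (S.filter fun i => i ≤ j) s (j - s)
      (fun i hi => by have := (Finset.mem_filter.1 hi).2; lia)
      (T := {z | z - y ∈ plate B i₀ δ (2 * (2:ℝ) ^ j)})
      (U := (fun z => z - y) ⁻¹' plate B i₀ δ (2 * (2:ℝ) ^ j + d * (2:ℝ) ^ j)) hT (by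
        rintro ⟨k, m⟩ - hk ⟨z, hz, hzT⟩ z' hz'
        have h1 : z' - y = (z - y) + (z' - z) := by abel
        rw [Set.mem_preimage, h1]
        refine add_mem_plate hδ1 (by positivity) hzT ((norm_sub_le_of_mem_dcube hz' hz).trans ?_)
        have h2 : (2:ℝ) ^ k ≤ δ * (2:ℝ) ^ j := by
          calc (2:ℝ) ^ k ≤ (2:ℝ) ^ (-(s:ℤ) + j) := zpow_le_zpow_right₀ one_le_two (by
                simp only at hk; lia)
            _ = (2:ℝ) ^ (-(s:ℤ)) * (2:ℝ) ^ j := zpow_add₀ two_ne_zero _ _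
            _ ≤ _ := by gcongr
        calc (d:ℝ) * (2:ℝ) ^ k ≤ d * (δ * (2:ℝ) ^ j) := by gcongr
          _ = _ := by ring)
    refine (mul_le_mul_right h _).trans ?_
    rw [hvol, ← ENNReal.ofReal_mul hα, ← ENNReal.ofReal_mul (by positivity)]
    refine ENNReal.ofReal_le_ofReal (le_of_eq ?_)
    calc _ = a * α * ((16 * (2:ℝ) ^ (-j)) * (2 * (2 * (2:ℝ) ^ j + d * (2:ℝ) ^ j))) ^ d *
          δ ^ (d - 1) := by
          rw [mul_pow (16 * (2:ℝ) ^ (-j))]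
          ring
      _ = a * α * (32 * (d + 2) * ((2:ℝ) ^ (-j) * (2:ℝ) ^ j)) ^ d * δ ^ (d - 1) := by
          congr 3
          ring
      _ = _ := by rw [hinv, mul_one]
  · gcongr
    exact sum_lintegral_absBsum_le hB.2.2.1 S s

lemma sum_cutoff_sq_le {d : ℕ} (hd : 2 ≤ d) {Φ : ℝ → ℝ} (hΦ : CutoffHyp Φ) {V : Type*}
    [Fintype V] (e : V → Rd d) {δ : ℝ} (hδ : 0 < δ) (hδ1 : δ ≤ 1) (he : ∀ v, ‖e v‖ = 1)
    (hsep : ∀ v v', v ≠ v' → δ / 16 ≤ ‖e v - e v'‖) {ξ : Rd d} (hξ : ξ ≠ 0) :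
    ∑ v, Φ (δ⁻¹ * ⟪e v, ‖ξ‖⁻¹ • ξ⟫) ^ 2 ≤ 2 * d * (258 * d) ^ d * δ⁻¹ ^ (d - 2) := by
  classical
  obtain ⟨-, h01, -, hzero⟩ := hΦ
  have hu : ‖‖ξ‖⁻¹ • ξ‖ = 1 := by
    rw [norm_smul, norm_inv, norm_norm, inv_mul_cancel₀ (norm_ne_zero_iff.2 hξ)]
  refine le_trans ?_ (card_separated_equator_le hd e hδ hδ1 he hsep hu
    (Finset.univ.filter fun v => |⟪‖ξ‖⁻¹ • ξ, e v⟫| ≤ 4 * δ)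
    fun v hv => (Finset.mem_filter.1 hv).2)
  rw [Finset.card_filter, Nat.cast_sum]
  refine Finset.sum_le_sum fun v _ => ?_
  split_ifs with h
  · push_cast
    exact pow_le_one₀ (h01 _).1 (h01 _).2
  · rw [hzero]
    · simp
    · rw [abs_mul, abs_of_pos (inv_pos.2 hδ), real_inner_comm, inv_mul_eq_div, lt_div_iff₀ hδ]
      exact not_le.1 h

/-- `L²` estimate with exponential decay for `Σ_j Σ_v G_v^s T_j^v 𝔅_{j-s}`. -/
theorem Gv_Tjv_l2_bound :
    ∀ d : ℕ, 2 ≤ d →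
    ∀ γ : ℝ, 0 < γ → γ < 1 →
    ∀ φ : Rd d → ℝ, AdmissiblePhi d φ →
    ∀ Φ : ℝ → ℝ, CutoffHyp Φ →
    ∃ C : ℝ, 0 < C ∧
      ∀ s : ℕ, 200 ≤ s →
      ∀ (V : Type) (_ : Fintype V) (e : V → Rd d) (E : V → Set (Rd d)),
        MicroFamily d γ s e E →
      ∀ (Om : Rd d → ℝ) (Mb : ℝ), Homogeneous0 d Om →
        (∀ x : Rd d, x ≠ 0 → |Om x| ≤ Mb) →
      ∀ (Qset : Set (ℤ × (Fin d → ℤ))) (b : ℤ × (Fin d → ℤ) → Rd d → ℝ) (α : ℝ),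
        0 < α → BadFam d Qset b α →
        (eLpNorm
            (fun x : Rd d => ∑' j : ℤ, ∑ v : V,
              Gop d Φ γ s (e v)
                (fun y => ((Tjv d φ Om (E v) j (bsum d Qset b (j - (s:ℤ))) y : ℝ) : ℂ)) x)
            2 volume) ^ (2:ℝ) ≤
          ENNReal.ofReal (C * Mb^2 * (2:ℝ) ^ (-(s:ℝ) * γ) * α) *
            ∑' q : Qset, ENNReal.ofReal (∫ x : Rd d, |b q.1 x|) := by
  intro d hd γ hγ hγ1 φ hφ Φ hΦ
  obtain ⟨C₀, hC₀⟩ : ∃ C₀, ∀ x, ‖φ x‖ ≤ C₀ := by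
    have hcomp : HasCompactSupport φ := by
      refine (isCompact_closedBall (0 : Rd d) 1).of_isClosed_subset (isClosed_tsupport φ)
        fun x hx => ?_
      have h := (hφ.2.1 hx).2
      rw [mem_closedBall_zero_iff]
      exact h.le.trans (by norm_num)
    exact hcomp.exists_bound_of_continuous hφ.1.continuous
  have hC0 : 0 ≤ C₀ := (norm_nonneg _).trans (hC₀ 0)
  have hφC : ∀ x, |φ x| ≤ C₀ + 1 := fun x => (hC₀ x).trans (by linarith)
  have hd0 : (0:ℝ) < d := by exact_mod_cast (by lia : 0 < d)
  set N₀ : ℝ := 2 * d * (258 * d) ^ d with hN₀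
  have hN0 : 0 < N₀ := by positivity
  refine ⟨N₀ * N₀ * (2 * (C₀ + 1) ^ 2 * 32 ^ d * (32 * (d + 2)) ^ d), by positivity, ?_⟩
  intro s hs V _ e E hE Om Mb hOm hMb Qset b α hα hB
  obtain ⟨he, hsep, hEm, hEs, -, heE, hdiam, -⟩ := hE
  set δ : ℝ := (2:ℝ) ^ (-(s:ℝ) * γ) with hδdef
  have hδ : 0 < δ := by positivity
  have hδ1 : δ ≤ 1 := Real.rpow_le_one_of_one_le_of_nonpos one_le_two (by
    rw [neg_mul]; exact neg_nonpos.2 (by positivity))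
  have hδinv : (2:ℝ) ^ (γ * s) = δ⁻¹ := by
    rw [hδdef, ← Real.rpow_neg zero_le_two]
    congr 1
    ring
  have hδs : (2:ℝ) ^ (-(s:ℤ)) ≤ δ := by
    rw [hδdef, ← Real.rpow_intCast]
    refine Real.rpow_le_rpow_of_exponent_le one_le_two ?_
    push_cast
    have : (0:ℝ) ≤ s := by positivity
    nlinarith
  have hsep' : ∀ v v', v ≠ v' → δ / 16 ≤ ‖e v - e v'‖ := fun v v' h => by
    refine le_trans (le_of_eq ?_) (hsep v v' h)
    rw [Real.rpow_sub two_pos]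
    norm_num [hδdef]
  have hdiam' : ∀ v, Metric.diam (E v) ≤ δ := fun v => by
    refine (hdiam v).trans ?_
    exact Real.rpow_le_rpow_of_exponent_le one_le_two (by linarith)
  have hMb0 : 0 ≤ Mb := by
    let x : Rd d := EuclideanSpace.basisFun (Fin d) ℝ ⟨0, by lia⟩
    have hx : ‖x‖ = 1 := OrthonormalBasis.norm_eq_one _ _
    exact (abs_nonneg _).trans (hMb x (norm_ne_zero_iff.1 (by rw [hx]; exact one_ne_zero)))
  let i₀ : Fin d := ⟨0, by lia⟩
  choose B hBe using fun v => exists_orthonormalBasis_of_norm_eq_one i₀ (he v)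
  set T : ℝ≥0∞ := ∑' q : Qset, ENNReal.ofReal (∫ x, |b q.1 x|) with hT
  set a : ℝ := (C₀ + 1) * Mb with ha
  have ha0 : 0 ≤ a := by positivity
  set R : ℝ≥0∞ := 2 * ENNReal.ofReal (a * 32 ^ d * δ ^ (d - 1)) *
      ENNReal.ofReal (a * α * (32 * (d + 2)) ^ d * δ ^ (d - 1)) with hR
  have hRtop : R ≠ ∞ := by
    rw [hR]
    exact ENNReal.mul_ne_top (ENNReal.mul_ne_top ENNReal.ofNat_ne_top ENNReal.ofReal_ne_top)
      ENNReal.ofReal_ne_top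
  have hconst : ENNReal.ofReal (N₀ * δ⁻¹ ^ (d - 2)) *
      (ENNReal.ofReal (N₀ * δ⁻¹ ^ (d - 1)) * R) =
      ENNReal.ofReal (N₀ * N₀ * (2 * (C₀ + 1) ^ 2 * 32 ^ d * (32 * (d + 2)) ^ d) *
        Mb ^ 2 * δ * α) := by
    rw [hR, show (2 : ℝ≥0∞) = ENNReal.ofReal 2 by simp, ← ENNReal.ofReal_mul (by positivity),
      ← ENNReal.ofReal_mul (by positivity), ← ENNReal.ofReal_mul (by positivity),
      ← ENNReal.ofReal_mul (by positivity)]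
    congr 1
    obtain ⟨n, rfl⟩ : ∃ n, d = n + 2 := ⟨d - 2, by lia⟩
    have e1 : n + 2 - 1 = n + 1 := by lia
    rw [e1, Nat.add_sub_cancel, ha]
    have e2 : δ⁻¹ ^ n * δ⁻¹ ^ (n + 1) * (δ ^ (n + 1) * δ ^ (n + 1)) = δ := by
      rw [pow_succ δ n]
      have : δ⁻¹ ^ n * δ ^ n = 1 := by rw [← mul_pow, inv_mul_cancel₀ hδ.ne', one_pow]
      have h3 : δ⁻¹ ^ (n + 1) * (δ ^ n * δ) = 1 := by
        rw [← pow_succ, ← mul_pow, inv_mul_cancel₀ hδ.ne', one_pow]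
      calc _ = (δ⁻¹ ^ n * δ ^ n) * (δ⁻¹ ^ (n + 1) * (δ ^ n * δ)) * δ := by ring
        _ = δ := by rw [this, h3]; ring
    conv_rhs => rw [← e2]
    ring
  have hsq : ∀ F : Rd d → ℂ, eLpNorm F 2 volume ^ (2:ℝ) = ∫⁻ x, ‖F x‖ₑ ^ 2 := fun F => by
    rw [← sq_eLpNorm_two]
    exact_mod_cast ENNReal.rpow_natCast _ 2
  rw [hsq, ← hconst]
  by_cases hRT : R * T = ∞
  · have hT' : T = ∞ := by
      rcases ENNReal.mul_eq_top.1 hRT with h | h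
      · exact h.2
      · exact absurd h.1 hRtop
    have hR0 : R ≠ 0 := fun h => by simp [h] at hRT
    have h1 : ENNReal.ofReal (N₀ * δ⁻¹ ^ (d - 2)) ≠ 0 := by
      rw [Ne, ENNReal.ofReal_eq_zero, not_le]; positivity
    have h2 : ENNReal.ofReal (N₀ * δ⁻¹ ^ (d - 1)) ≠ 0 := by
      rw [Ne, ENNReal.ofReal_eq_zero, not_le]; positivity
    rw [hT', ENNReal.mul_top (mul_ne_zero h1 (mul_ne_zero h2 hR0))]
    exact le_top
  set β : ℤ → Rd d → ℝ≥0∞ := fun j => absBsum d Qset b (j - s) with hβ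
  let D : Finset ℤ → V → Rd d → ℝ≥0∞ := fun S v x =>
    ∑ j ∈ S, ENNReal.ofReal (a * (16 * (2:ℝ) ^ (-j)) ^ d) *
      ∫⁻ y in {y | x - y ∈ plate (B v) i₀ δ ((2:ℝ) ^ j)}, β j y
  have hD2 : ∀ S v, ∫⁻ x, D S v x ^ 2 ≤ R * T := fun S v =>
    lintegral_sq_sum_plate_le hδs hδ1 hα.le hB (B v) i₀ ha0 S
  have hpt : ∀ S v x, ∑ j ∈ S,
      ‖((Tjv d φ Om (E v) j (bsum d Qset b (j - (s:ℤ))) x : ℝ) : ℂ)‖ₑ ≤ D S v x := by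
    intro S v x
    refine Finset.sum_le_sum fun j _ => ?_
    have h1 : ‖((Tjv d φ Om (E v) j (bsum d Qset b (j - (s:ℤ))) x : ℝ) : ℂ)‖ₑ =
        ‖Tjv d φ Om (E v) j (bsum d Qset b (j - (s:ℤ))) x‖ₑ := by
      rw [← ofReal_norm, ← ofReal_norm, Complex.norm_real]
    rw [h1]
    exact enorm_integral_mul_le (measurableSet_plate (B v) i₀ δ _)
      (abs_Kv_le hφ hφC hMb (hEs v) hδ.le (hdiam' v) (by rw [hBe]; exact heE v) j)
      (fun y => enorm_bsum_le Qset b _ y) x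
  have hmain := fun S : Finset ℤ => lintegral_sum_multiplier_le S
    (fun v ξ => Φ ((2:ℝ) ^ (γ * s) * ⟪e v, ‖ξ‖⁻¹ • ξ⟫))
    (fun v ξ => by rw [abs_of_nonneg (hΦ.2.1 _).1]; exact (hΦ.2.1 _).2)
    (N := N₀ * δ⁻¹ ^ (d - 2)) (by
      have : Nonempty (Fin d) := ⟨i₀⟩
      have h0 : ∀ᵐ ξ : Rd d, ξ ≠ 0 := by
        rw [ae_iff]
        simp
      filter_upwards [h0] with ξ hξ
      rw [hδinv]
      exact sum_cutoff_sq_le hd hΦ e hδ hδ1 he hsep' hξ)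
    (fun j v y => ((Tjv d φ Om (E v) j (bsum d Qset b (j - (s:ℤ))) y : ℝ) : ℂ))
    (D S) (hpt S) (fun v => ne_top_of_le_ne_top hRT (hD2 S v))
  refine lintegral_enorm_tsum_sq_le (fun S => (hmain S).1.measurable) fun S => ?_
  refine (hmain S).2.trans ?_
  rw [mul_assoc (ENNReal.ofReal _) (_ * R), mul_assoc (ENNReal.ofReal _) R]
  refine mul_le_mul' le_rfl ?_
  calc ∑ v, ∫⁻ x, D S v x ^ 2 ≤ ∑ _v : V, R * T := Finset.sum_le_sum fun v _ => hD2 S v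
    _ = ENNReal.ofReal (Fintype.card V) * (R * T) := by
        rw [Finset.sum_const, nsmul_eq_mul, Finset.card_univ, ENNReal.ofReal_natCast]
    _ ≤ _ := by
        gcongr
        exact card_separated_le hd e hδ hδ1 he hsep'
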